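/- For every integer g ≥ 0, every graph with Euler genus g is contained in H ⊠ P ⊠ K_{max{2g,3}} for some planar graph H with treewidth at most 3 and for some path P. -/

import Mathlib

/-!
Common definitions: multigraphs, combinatorial (cellular) surface embeddings,
Euler genus, framed graphs, strong products, treewidth, partitions and layerings.
-/

/-- A multigraph on vertex type `V` with edge type `E`, given by its endpoints map. -/
structure Multigraph (V E : Type) where
  ends : E → Sym2 V

namespace Multigraph

variable {V E F : Type}

/-- The simple graph underlying a multigraph. -/
def simple (G : Multigraph V E) : SimpleGraph V where
  Adj u v := u ≠ v ∧ ∃ e, G.ends e = s(u, v)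
  symm := by
    refine ⟨?_⟩
    rintro u v ⟨hne, e, he⟩
    exact ⟨hne.symm, e, he.trans Sym2.eq_swap⟩
  loopless := by refine ⟨?_⟩; rintro u ⟨hne, -⟩; exact hne rfl

/-- The simple graph on `V` whose edges are the edges of `G` lying in `S`. -/
def simpleOn (G : Multigraph V E) (S : Set E) : SimpleGraph V where
  Adj u v := u ≠ v ∧ ∃ e ∈ S, G.ends e = s(u, v)
  symm := by
    refine ⟨?_⟩
    rintro u v ⟨hne, e, heS, he⟩
    exact ⟨hne.symm, e, heS, he.trans Sym2.eq_swap⟩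
  loopless := by refine ⟨?_⟩; rintro u ⟨hne, -⟩; exact hne rfl

/-- A multigraph is simple: no loops and no parallel edges. -/
def IsSimple (G : Multigraph V E) : Prop :=
  (∀ e, ¬ (G.ends e).IsDiag) ∧ Function.Injective G.ends

/-- A set `S` of edges of `G` forms a spanning tree of `G`. -/
def IsSpanningTree (G : Multigraph V E) (S : Set E) : Prop :=
  (G.simpleOn S).IsTree ∧ (∀ e ∈ S, ¬ (G.ends e).IsDiag) ∧
    ∀ e ∈ S, ∀ e' ∈ S, G.ends e = G.ends e' → e = e'

/-- A closed walk in a multigraph, recorded as periodic sequences of vertices and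
edges: the walk visits `vtx 0, vtx 1, …, vtx (len - 1)` and returns to
`vtx len = vtx 0`, traversing the edge `edge i` between `vtx i` and `vtx (i+1)`. -/
structure CWalk (G : Multigraph V E) where
  len : ℕ
  len_pos : 0 < len
  vtx : ℕ → V
  edge : ℕ → E
  vtx_per : ∀ i, vtx (i + len) = vtx i
  edge_per : ∀ i, edge (i + len) = edge i
  compat : ∀ i, G.ends (edge i) = s(vtx i, vtx (i + 1))

namespace CWalk

variable {G : Multigraph V E}

/-- The vertex `v` lies on the closed walk `W`. -/
def HasVtx (W : G.CWalk) (v : V) : Prop := ∃ i, i < W.len ∧ W.vtx i = v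

/-- The edge `e` lies on the closed walk `W`. -/
def HasEdge (W : G.CWalk) (e : E) : Prop := ∃ i, i < W.len ∧ W.edge i = e

/-- The closed walk `W` is a cycle: it repeats no vertex and no edge. -/
def IsCycle (W : G.CWalk) : Prop :=
  (∀ i j, i < W.len → j < W.len → W.vtx i = W.vtx j → i = j) ∧
  (∀ i j, i < W.len → j < W.len → W.edge i = W.edge j → i = j)

end CWalk

/-- `p = (f, i)` is an occurrence of the edge `e` in the family `bd` of closed walks:
the walk of face `f` traverses `e` at position `i`. -/
def IsOcc {G : Multigraph V E} (bd : F → G.CWalk) (e : E) (p : F × ℕ) : Prop :=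
  p.2 < (bd p.1).len ∧ (bd p.1).edge p.2 = e

/-- `c = (f, i)` is a corner of the vertex `v`: the walk of face `f` visits `v`
at position `i`. -/
def IsCorner {G : Multigraph V E} (bd : F → G.CWalk) (v : V) (c : F × ℕ) : Prop :=
  c.2 < (bd c.1).len ∧ (bd c.1).vtx c.2 = v

/-- The corner `c` is one of the two end corners of the edge occurrence `p`. -/
def EndOf {G : Multigraph V E} (bd : F → G.CWalk) (c p : F × ℕ) : Prop :=
  c.1 = p.1 ∧ (c.2 = p.2 ∨ c.2 = (p.2 + 1) % (bd p.1).len)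

/-- Two corners of `v` are linked if they are end corners (at `v`) of the two
distinct occurrences of a common edge; this is the edge-to-edge gluing relation
around the vertex `v`. -/
def CornerLinked {G : Multigraph V E} (bd : F → G.CWalk) (v : V) (c c' : F × ℕ) : Prop :=
  IsCorner bd v c ∧ IsCorner bd v c' ∧
    ∃ (e : E) (p p' : F × ℕ), p ≠ p' ∧ IsOcc bd e p ∧ IsOcc bd e p' ∧
      EndOf bd c p ∧ EndOf bd c' p'

/-- A combinatorial (cellular) embedding of a connected multigraph `G` in a closed
surface, with face set `F`: every face is given by its closed boundary walk, every
edge of `G` is traversed exactly twice in total by the boundary walks, and the link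
of every vertex is connected (so the embedding is in a genuine surface, with no
pinch points). -/
structure Embedding (G : Multigraph V E) (F : Type) where
  boundary : F → G.CWalk
  conn : G.simple.Connected
  edge_twice : ∀ e : E, {p : F × ℕ | IsOcc boundary e p}.ncard = 2
  link_conn : ∀ (v : V) (c c' : F × ℕ), IsCorner boundary v c → IsCorner boundary v c' →
    Relation.EqvGen (CornerLinked boundary v) c c'

/-- The Euler genus `2 - (|V| - |E| + |F|)` of an embedding, via Euler's formula. -/
noncomputable def Embedding.eulerGenus {G : Multigraph V E} {F : Type}
    (_ : Embedding G F) : ℤ :=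
  2 - ((Nat.card V : ℤ) - Nat.card E + Nat.card F)

/-- The simple graph underlying the framed multigraph `G^{(d)}`: two distinct
vertices are adjacent iff they are joined by an edge of `G` or lie on a common
face of length at most `d` (in which case `G^{(d)}` has a chord between them). -/
def framedGraph {G : Multigraph V E} {F : Type} (emb : Embedding G F) (d : ℕ) :
    SimpleGraph V where
  Adj u v := u ≠ v ∧ ((∃ e, G.ends e = s(u, v)) ∨
    ∃ f, (emb.boundary f).len ≤ d ∧ (emb.boundary f).HasVtx u ∧ (emb.boundary f).HasVtx v)
  symm := by
    refine ⟨?_⟩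
    rintro u v ⟨hne, (⟨e, he⟩ | ⟨f, h1, h2, h3⟩)⟩
    · exact ⟨hne.symm, Or.inl ⟨e, he.trans Sym2.eq_swap⟩⟩
    · exact ⟨hne.symm, Or.inr ⟨f, h1, h3, h2⟩⟩
  loopless := by refine ⟨?_⟩; rintro u ⟨hne, -⟩; exact hne rfl

end Multigraph

namespace SimpleGraph

/-- `G` is contained in `X`: `G` is isomorphic to a subgraph of `X`. -/
def IsContainedIn {α β : Type} (G : SimpleGraph α) (X : SimpleGraph β) : Prop :=
  ∃ f : G →g X, Function.Injective f

/-- The strong product of two simple graphs. -/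
def strongProd {α β : Type} (G : SimpleGraph α) (H : SimpleGraph β) :
    SimpleGraph (α × β) where
  Adj x y := x ≠ y ∧ (x.1 = y.1 ∨ G.Adj x.1 y.1) ∧ (x.2 = y.2 ∨ H.Adj x.2 y.2)
  symm := by
    refine ⟨?_⟩
    rintro x y ⟨hne, h1, h2⟩
    exact ⟨hne.symm, h1.imp Eq.symm (fun h => G.symm.symm _ _ h), h2.imp Eq.symm (fun h => H.symm.symm _ _ h)⟩
  loopless := by refine ⟨?_⟩; rintro x ⟨hne, -⟩; exact hne rfl

end SimpleGraph

/-- `G` has treewidth at most `k`: it has a tree-decomposition with all bags of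
size at most `k + 1`. -/
def TreewidthLE {α : Type} (G : SimpleGraph α) (k : ℕ) : Prop :=
  ∃ (ι : Type) (T : SimpleGraph ι) (B : ι → Set α),
    T.IsTree ∧
    (∀ v, ∃ i, v ∈ B i) ∧
    (∀ u v, G.Adj u v → ∃ i, u ∈ B i ∧ v ∈ B i) ∧
    (∀ v, (T.induce {i | v ∈ B i}).Connected) ∧
    ∀ i, (B i).encard ≤ (k : ℕ∞) + 1

/-- `G` has Euler genus at most `g`: `G` is (isomorphic to) a subgraph of a
multigraph having a combinatorial embedding of Euler genus at most `g`. -/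
def HasEulerGenusLE {α : Type} (G : SimpleGraph α) (g : ℕ) : Prop :=
  ∃ (V' E' F' : Type), Finite V' ∧ Finite E' ∧ Finite F' ∧
    ∃ (M : Multigraph V' E') (emb : M.Embedding F'),
      emb.eulerGenus ≤ (g : ℤ) ∧ G.IsContainedIn M.simple

/-- A planar graph: a graph of Euler genus `0`. -/
def IsPlanar {α : Type} (G : SimpleGraph α) : Prop := HasEulerGenusLE G 0

/-- An apex graph: deleting some vertex leaves a planar graph. -/
def IsApex {α : Type} (G : SimpleGraph α) : Prop :=
  ∃ v : α, IsPlanar (G.induce {w | w ≠ v})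

/-- `A` indexes a partition of the vertices of `G` into nonempty parts `A x`, and the
quotient of `G` by this partition is (isomorphic to) `H`, via the indexing: this is an
`H`-partition of `G`. -/
def IsHPartition {α W : Type} (G : SimpleGraph α) (H : SimpleGraph W) (A : W → Set α) : Prop :=
  (∀ x, (A x).Nonempty) ∧ (∀ v, ∃! x, v ∈ A x) ∧
    ∀ x y, x ≠ y → (H.Adj x y ↔ ∃ u ∈ A x, ∃ v ∈ A y, G.Adj u v)

/-- `(L 0, L 1, …)` is a layering of `G`: an ordered partition of the vertices such
that every edge joins vertices in the same or in consecutive layers. -/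
def IsLayering {α : Type} (G : SimpleGraph α) (L : ℕ → Set α) : Prop :=
  (∀ v, ∃! j, v ∈ L j) ∧
    ∀ u v, G.Adj u v → ∀ i j, u ∈ L i → v ∈ L j → i ≤ j + 1 ∧ j ≤ i + 1

/-- `b` lies on every walk from `a` to `c` in `T` (for a tree: `b` is on the unique
`a`–`c` path). -/
def BtwIn {α : Type} (T : SimpleGraph α) (a b c : α) : Prop :=
  ∀ p : T.Walk a c, b ∈ p.support

/-- `Q` is the vertex set of a vertical path in the tree `T` rooted at `r` with upper
end `w` and lower end `u`: `w` lies on the path from `r` to `u`, and `Q` is the set of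
vertices of the `w`–`u` path. -/
def IsVerticalPathBtw {α : Type} (T : SimpleGraph α) (r : α) (Q : Set α) (w u : α) : Prop :=
  BtwIn T r w u ∧ Q = {x | BtwIn T w x u}

/-- `Q` is the vertex set of a vertical path in the tree `T` rooted at `r`. -/
def IsVerticalPath {α : Type} (T : SimpleGraph α) (r : α) (Q : Set α) : Prop :=
  ∃ w u, IsVerticalPathBtw T r Q w u

/-- `Y` is the union of at most `k` vertical paths in the tree `T` rooted at `r`. -/
def IsUnionOfVPaths {α : Type} (T : SimpleGraph α) (r : α) (k : ℕ) (Y : Set α) : Prop :=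
  ∃ m, m ≤ k ∧ ∃ Q : Fin m → Set α, (∀ i, IsVerticalPath T r (Q i)) ∧ Y = ⋃ i, Q i

/-! ### Planar multigraphs presented by lists of faces -/

/-- Cyclically consecutive pairs of a list. -/
def cor {α : Type} (l : List α) : List (α × α) := l.zip (l.rotate 1)

theorem cor3 {α : Type} (x y z : α) : cor [x, y, z] = [(x, y), (y, z), (z, x)] := rfl

theorem cor1 {α : Type} (x : α) : cor [x] = [(x, x)] := by simp [cor]

theorem cor_fst {α : Type} {l : List α} {x : α × α} (h : x ∈ cor l) : x.1 ∈ l :=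
  (List.of_mem_zip h).1

/-- A planar map on vertices `0..n-1` and edges `0..m-1` presented by a list of faces. -/
structure PF (n m : ℕ) (ends : ℕ → Sym2 ℕ) (fs : List (List (ℕ × ℕ))) : Prop where
  ne : ∀ l ∈ fs, l ≠ []
  bd : ∀ l ∈ fs, ∀ d ∈ l, d.1 < n ∧ d.2 < m
  ok : ∀ l ∈ fs, ∀ x ∈ cor l, ends x.1.2 = s(x.1.1, x.2.1)
  cnt : ∀ e < m, (fs.map (List.countP (fun d => d.2 = e))).sum = 2
  link : ∀ v < n, ∀ s : ℕ → Prop,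
    (∀ l ∈ fs, ∀ x ∈ cor l, x.2.1 = v → (s x.1.2 ↔ s x.2.2)) →
    ∀ e < m, ∀ e' < m, v ∈ ends e → v ∈ ends e' → (s e ↔ s e')
  conn : ∀ v < n, 0 < v → ∃ u < v, ∃ e < m, ends e = s(u, v)
  euler : n + fs.length = m + 2

theorem PF.perm {n m : ℕ} {ends : ℕ → Sym2 ℕ} {fs fs' : List (List (ℕ × ℕ))}
    (h : PF n m ends fs) (hp : fs.Perm fs') : PF n m ends fs' where
  ne := fun l hl => h.ne l (hp.mem_iff.2 hl)
  bd := fun l hl => h.bd l (hp.mem_iff.2 hl)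
  ok := fun l hl => h.ok l (hp.mem_iff.2 hl)
  cnt := fun e he => by rw [← h.cnt e he]; exact ((hp.map _).sum_eq).symm
  link := fun v hv s hs => h.link v hv s (fun l hl => hs l (hp.mem_iff.1 hl))
  conn := h.conn
  euler := by rw [← hp.length_eq]; exact h.euler

theorem PF.rot {n m : ℕ} {ends : ℕ → Sym2 ℕ} {fs : List (List (ℕ × ℕ))} {x y z : ℕ × ℕ}
    (h : PF n m ends ([x, y, z] :: fs)) : PF n m ends ([y, z, x] :: fs) where
  ne := by have := h.ne; simp at this ⊢; exact this
  bd := by have := h.bd; simp only [List.forall_mem_cons] at this ⊢; tauto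
  ok := by
    have := h.ok; simp only [List.forall_mem_cons, cor3] at this ⊢; tauto
  cnt := fun e he => by
    rw [← h.cnt e he]; simp [List.countP_cons]; omega
  link := fun v hv s hs => h.link v hv s (by simp only [List.forall_mem_cons, cor3] at hs ⊢; tauto)
  conn := h.conn
  euler := h.euler

theorem PF.cnt_zero {n m : ℕ} {fs : List (List (ℕ × ℕ))}
    (h : ∀ l ∈ fs, ∀ d ∈ l, d.1 < n ∧ d.2 < m) {e : ℕ} (he : m ≤ e) :
    (fs.map (List.countP (fun d => d.2 = e))).sum = 0 := by
  rw [List.sum_eq_zero_iff]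
  intro x hx
  rw [List.mem_map] at hx
  obtain ⟨l, hl, rfl⟩ := hx
  rw [List.countP_eq_zero]
  intro d hd
  have := (h l hl d hd).2
  simp; omega

theorem PF.base : PF 1 3 (fun _ => s(0, 0)) [[(0, 0), (0, 1), (0, 2)], [(0, 0)], [(0, 1)], [(0, 2)]] where
  ne := by simp
  bd := by simp only [List.forall_mem_cons]; simp
  ok := by simp only [List.forall_mem_cons, cor3, cor1]; simp
  cnt := by intro e he; interval_cases e <;> simp [List.countP_cons]
  link := by
    intro v hv s hs e he e' he' _ _
    have hv0 : v = 0 := by omega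
    subst hv0
    simp only [List.forall_mem_cons, cor3, cor1] at hs
    simp at hs
    interval_cases e <;> interval_cases e' <;> tauto
  conn := by intro v hv h; omega
  euler := by simp

theorem PF.stack {n m : ℕ} {ends : ℕ → Sym2 ℕ} {fs : List (List (ℕ × ℕ))} {a b c e1 e2 e3 : ℕ}
    (h : PF n m ends ([(a, e1), (b, e2), (c, e3)] :: fs)) :
    PF (n + 1) (m + 3) (fun e => if e < m then ends e else if e = m then s(a, n)
      else if e = m + 1 then s(b, n) else s(c, n))
      ([(a, e1), (b, m + 1), (n, m)] :: [(b, e2), (c, m + 2), (n, m + 1)] ::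
        [(c, e3), (a, m), (n, m + 2)] :: fs) where
  ne := by have := h.ne; simp at this ⊢; exact this
  bd := by
    have h0 := h.bd
    simp only [List.forall_mem_cons] at h0 ⊢
    obtain ⟨⟨h1, h2, h3, -⟩, h4⟩ := h0
    refine ⟨⟨⟨?_, ?_⟩, ⟨?_, ?_⟩, ⟨?_, ?_⟩, by simp⟩, ⟨⟨?_, ?_⟩, ⟨?_, ?_⟩, ⟨?_, ?_⟩, by simp⟩,
      ⟨⟨?_, ?_⟩, ⟨?_, ?_⟩, ⟨?_, ?_⟩, by simp⟩, ?_⟩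
    all_goals try omega
    intro l hl d hd
    have := h4 l hl d hd
    omega
  ok := by
    have h0 := h.ok
    have hb := h.bd
    simp only [List.forall_mem_cons] at h0 hb ⊢
    obtain ⟨⟨h1, h2, h3, -⟩, h4⟩ := hb
    obtain ⟨h5, h6⟩ := h0
    refine ⟨?_, ?_, ?_, ?_⟩
    · simp only [List.forall_mem_cons, cor3] at h5 ⊢; simp [h1.2] at h5 ⊢; simp [h5]
    · simp only [List.forall_mem_cons, cor3] at h5 ⊢; simp [h2.2] at h5 ⊢; simp [h5]
    · simp only [List.forall_mem_cons, cor3] at h5 ⊢; simp [h3.2] at h5 ⊢; simp [h5]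
    · intro l hl x hx
      have : x.1 ∈ l := cor_fst hx
      simp [(h4 l hl _ this).2, h6 l hl x hx]
  cnt := by
    intro e he
    by_cases hem : e < m
    · refine Eq.trans ?_ (h.cnt e hem)
      have k1 : m ≠ e := by omega
      have k2 : m + 1 ≠ e := by omega
      have k3 : m + 2 ≠ e := by omega
      simp [List.countP_cons, k1, k2, k3]; omega
    · have hz := PF.cnt_zero h.bd (show m ≤ e by omega)
      simp only [List.map_cons, List.sum_cons, Nat.add_eq_zero_iff] at hz ⊢
      rw [hz.2]
      have hb := h.bd
      simp only [List.forall_mem_cons] at hb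
      obtain ⟨⟨h1, h2, h3, -⟩, h4⟩ := hb
      have k1 : e1 ≠ e := by omega
      have k2 : e2 ≠ e := by omega
      have k3 : e3 ≠ e := by omega
      have : e = m ∨ e = m + 1 ∨ e = m + 2 := by omega
      rcases this with rfl | rfl | rfl <;> simp [List.countP_cons, k1, k2, k3]
  link := by
    intro v hv s hs
    have hb := h.bd
    have h0 := h.ok
    simp only [List.forall_mem_cons] at hb hs h0
    obtain ⟨⟨h1, h2, h3, -⟩, h4⟩ := hb
    obtain ⟨s1, s2, s3, s4⟩ := hs
    obtain ⟨h5, -⟩ := h0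
    simp only [List.forall_mem_cons, cor3] at s1 s2 s3 h5
    obtain ⟨p1, p2, p3, -⟩ := s1
    obtain ⟨q1, q2, q3, -⟩ := s2
    obtain ⟨t1, t2, t3, -⟩ := s3
    by_cases hvn : v = n
    · subst hvn
      intro e he e' he' hve hve'
      have key : ∀ e < m + 3, v ∈ (if e < m then ends e else if e = m then s(a, v)
          else if e = m + 1 then s(b, v) else s(c, v)) → (s e ↔ s m) := by
        intro e he hve
        by_cases hem : e < m
        · exfalso
          rw [if_pos hem] at hve
          have hc := h.cnt e hem
          by_contra hcon
          have : (List.map (List.countP fun d => decide (d.2 = e)) ([(a, e1), (b, e2), (c, e3)] :: fs)).sum = 0 := by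
            rw [List.sum_eq_zero_iff]
            intro x hx
            rw [List.mem_map] at hx
            obtain ⟨l, hl, rfl⟩ := hx
            rw [List.countP_eq_zero]
            intro d hd
            have hd' := hd
            simp only [decide_eq_true_eq]
            intro hde
            obtain ⟨i, hi, hid⟩ := List.getElem_of_mem hd
            have hil : i < (l.rotate 1).length := by simpa using hi
            have hx : (d, (l.rotate 1)[i]) ∈ cor l := by
              rw [cor, List.mem_iff_getElem]
              exact ⟨i, by simp [hi], by simp [hid]⟩
            have hok := h.ok l hl _ hx
            simp only at hok
            rw [hde] at hok
            rw [hok, Sym2.mem_iff] at hve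
            have b1 := (h.bd l hl d hd).1
            have b2 := (h.bd l hl _ (List.mem_rotate.1 (List.getElem_mem hil))).1
            omega
          omega
        · have : e = m ∨ e = m + 1 ∨ e = m + 2 := by omega
          rcases this with rfl | rfl | rfl
          · exact Iff.rfl
          · exact p2 rfl
          · exact (t2 rfl).symm
      rw [key e he hve, key e' he' hve']
    · have hv' : v < n := by omega
      have old := h.link v hv' s (by
        simp only [List.forall_mem_cons]
        refine ⟨?_, s4⟩
        simp only [List.forall_mem_cons, cor3]
        exact ⟨fun hh => (p1 hh).trans (q3 hh), fun hh => (q1 hh).trans (t3 hh), fun hh => (t1 hh).trans (p3 hh), by simp⟩)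
      have key : ∀ e < m + 3, v ∈ (if e < m then ends e else if e = m then s(a, n)
          else if e = m + 1 then s(b, n) else s(c, n)) → ∃ e'' < m, v ∈ ends e'' ∧ (s e ↔ s e'') := by
        intro e he hve
        by_cases hem : e < m
        · rw [if_pos hem] at hve; exact ⟨e, hem, hve, Iff.rfl⟩
        · have : e = m ∨ e = m + 1 ∨ e = m + 2 := by omega
          rcases this with rfl | rfl | rfl
          · simp [hvn] at hve; subst hve
            exact ⟨e1, h1.2, by rw [h5.1]; simp, p3 rfl⟩
          · simp [hvn] at hve; subst hve
            exact ⟨e2, h2.2, by rw [h5.2.1]; simp, q3 rfl⟩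
          · simp [hvn] at hve; subst hve
            exact ⟨e3, h3.2, by rw [h5.2.2.1]; simp, t3 rfl⟩
      intro e he e' he' hve hve'
      obtain ⟨f, hf, hf1, hf2⟩ := key e he hve
      obtain ⟨f', hf', hf1', hf2'⟩ := key e' he' hve'
      rw [hf2, hf2']
      exact old f hf f' hf' hf1 hf1'
  conn := by
    intro v hv hv0
    by_cases hvn : v = n
    · subst hvn
      have h1 := h.bd _ (List.mem_cons_self) (a, e1) (by simp)
      exact ⟨a, h1.1, m, by omega, by simp⟩
    · obtain ⟨u, hu, e, he, hee⟩ := h.conn v (by omega) hv0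
      exact ⟨u, hu, e, by omega, by simp [he, hee]⟩
  euler := by have := h.euler; simp at this ⊢; omega

theorem PF.dup {n m : ℕ} {ends : ℕ → Sym2 ℕ} {fs : List (List (ℕ × ℕ))} {a b c e1 e2 e3 : ℕ}
    (h : PF n m ends ([(a, e1), (b, e2), (c, e3)] :: fs)) :
    PF n (m + 2) (fun e => if e < m then ends e else if e = m then s(a, b) else s(a, a))
      ([(a, e1), (b, m), (a, m + 1)] :: [(a, m + 1)] :: [(b, e2), (c, e3), (a, m)] :: fs) where
  ne := by have := h.ne; simp at this ⊢; exact this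
  bd := by
    have h0 := h.bd
    simp only [List.forall_mem_cons] at h0 ⊢
    obtain ⟨⟨h1, h2, h3, -⟩, h4⟩ := h0
    refine ⟨⟨⟨?_, ?_⟩, ⟨?_, ?_⟩, ⟨?_, ?_⟩, by simp⟩, ⟨⟨?_, ?_⟩, by simp⟩,
      ⟨⟨?_, ?_⟩, ⟨?_, ?_⟩, ⟨?_, ?_⟩, by simp⟩, ?_⟩
    all_goals try omega
    intro l hl d hd
    have := h4 l hl d hd
    omega
  ok := by
    have h0 := h.ok
    have hb := h.bd
    simp only [List.forall_mem_cons] at h0 hb ⊢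
    obtain ⟨⟨h1, h2, h3, -⟩, h4⟩ := hb
    obtain ⟨h5, h6⟩ := h0
    refine ⟨?_, ?_, ?_, ?_⟩
    · simp only [List.forall_mem_cons, cor3] at h5 ⊢; simp [h1.2] at h5 ⊢; simp [h5, Sym2.eq_swap]
    · simp [cor1]
    · simp only [List.forall_mem_cons, cor3] at h5 ⊢; simp [h2.2, h3.2] at h5 ⊢; simp [h5]
    · intro l hl x hx
      have : x.1 ∈ l := cor_fst hx
      simp [(h4 l hl _ this).2, h6 l hl x hx]
  cnt := by
    intro e he
    by_cases hem : e < m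
    · refine Eq.trans ?_ (h.cnt e hem)
      have k1 : m ≠ e := by omega
      have k2 : m + 1 ≠ e := by omega
      simp [List.countP_cons, k1, k2]; omega
    · have hz := PF.cnt_zero h.bd (show m ≤ e by omega)
      simp only [List.map_cons, List.sum_cons, Nat.add_eq_zero_iff] at hz ⊢
      rw [hz.2]
      have hb := h.bd
      simp only [List.forall_mem_cons] at hb
      obtain ⟨⟨h1, h2, h3, -⟩, h4⟩ := hb
      have k1 : e1 ≠ e := by omega
      have k2 : e2 ≠ e := by omega
      have k3 : e3 ≠ e := by omega
      have : e = m ∨ e = m + 1 := by omega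
      rcases this with rfl | rfl <;> simp [List.countP_cons, k1, k2, k3]
  link := by
    intro v hv s hs
    have hb := h.bd
    have h0 := h.ok
    simp only [List.forall_mem_cons] at hb hs h0
    obtain ⟨⟨h1, h2, h3, -⟩, h4⟩ := hb
    obtain ⟨s1, s2, s3, s4⟩ := hs
    obtain ⟨h5, -⟩ := h0
    simp only [List.forall_mem_cons, cor3] at s1 s3 h5
    obtain ⟨p1, p2, p3, -⟩ := s1
    obtain ⟨t1, t2, t3, -⟩ := s3
    have old := h.link v hv s (by
        simp only [List.forall_mem_cons]
        refine ⟨?_, s4⟩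
        simp only [List.forall_mem_cons, cor3]
        exact ⟨fun hh => (p1 hh).trans (t3 hh), fun hh => t1 hh, fun hh => (t2 hh).trans ((p2 hh).trans (p3 hh)), by simp⟩)
    have key : ∀ e < m + 2, v ∈ (if e < m then ends e else if e = m then s(a, b)
          else s(a, a)) → ∃ e'' < m, v ∈ ends e'' ∧ (s e ↔ s e'') := by
      intro e he hve
      by_cases hem : e < m
      · rw [if_pos hem] at hve; exact ⟨e, hem, hve, Iff.rfl⟩
      · have : e = m ∨ e = m + 1 := by omega
        rcases this with rfl | rfl
        · simp at hve
          rcases hve with rfl | rfl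
          · exact ⟨e1, h1.2, by rw [h5.1]; simp, (p2 rfl).trans (p3 rfl)⟩
          · exact ⟨e1, h1.2, by rw [h5.1]; simp, (p1 rfl).symm⟩
        · simp at hve; subst hve
          exact ⟨e1, h1.2, by rw [h5.1]; simp, p3 rfl⟩
    intro e he e' he' hve hve'
    obtain ⟨f, hf, hf1, hf2⟩ := key e he hve
    obtain ⟨f', hf', hf1', hf2'⟩ := key e' he' hve'
    rw [hf2, hf2']
    exact old f hf f' hf' hf1 hf1'
  conn := by
    intro v hv hv0
    obtain ⟨u, hu, e, he, hee⟩ := h.conn v (by omega) hv0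
    exact ⟨u, hu, e, by omega, by simp [he, hee]⟩
  euler := by have := h.euler; simp at this ⊢; omega



/-! ### Stacked triangulations together with a tree-decomposition -/

/-- Tree-decomposition data for the map. -/
structure TD (n m : ℕ) (ends : ℕ → Sym2 ℕ) (tris : List (ℕ × ℕ × ℕ)) (q : ℕ → ℕ)
    (B : ℕ → Finset ℕ) : Prop where
  qlt : ∀ j < n, 0 < j → q j < j
  self : ∀ j < n, j ∈ B j
  le : ∀ j < n, ∀ i ∈ B j, i ≤ j
  up : ∀ j < n, 0 < j → ∀ i ∈ B j, i ≠ j → i ∈ B (q j)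
  card : ∀ j < n, (B j).card ≤ 4
  edge : ∀ e < m, ∃ j < n, ∀ x ∈ ends e, x ∈ B j
  tri : ∀ t ∈ tris, ∃ j < n, t.1 ∈ B j ∧ t.2.1 ∈ B j ∧ t.2.2 ∈ B j

/-- The face `l` is a triangle with corners `t`. -/
def TriF (t : ℕ × ℕ × ℕ) (l : List (ℕ × ℕ)) : Prop :=
  ∃ e1 e2 e3, l = [(t.1, e1), (t.2.1, e2), (t.2.2, e3)]

/-- A planar map with `n` vertices, adjacency `A`, chosen triangles `tris` and a
tree-decomposition of width three. -/
def HS (n : ℕ) (A : ℕ → ℕ → Prop) (tris : List (ℕ × ℕ × ℕ)) : Prop :=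
  ∃ m ends fs rest q B, (∀ i j, A i j ↔ ∃ e < m, ends e = s(i, j)) ∧
    PF n m ends (fs ++ rest) ∧ List.Forall₂ TriF tris fs ∧ TD n m ends tris q B

theorem HS.base : ∃ A, HS 1 A [(0, 0, 0)] := by
  refine ⟨fun i j => ∃ e < 3, s(0, 0) = s(i, j), 3, fun _ => s(0, 0), [[(0, 0), (0, 1), (0, 2)]], [[(0, 0)], [(0, 1)], [(0, 2)]], fun _ => 0,
    fun _ => {0}, fun i j => Iff.rfl, PF.base, ?_, ?_⟩
  · refine List.Forall₂.cons ⟨0, 1, 2, rfl⟩ List.Forall₂.nil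
  · constructor <;> simp

theorem HS.rot {n A a b c ts} (h : HS n A ((a, b, c) :: ts)) : HS n A ((b, c, a) :: ts) := by
  obtain ⟨m, ends, fs, rest, q, B, hA, hP, hF, hT⟩ := h
  obtain ⟨l, fs, ⟨e1, e2, e3, rfl⟩, hF', rfl⟩ := List.forall₂_cons_left_iff.1 hF
  refine ⟨m, ends, [(b, e2), (c, e3), (a, e1)] :: fs, rest, q, B, hA, hP.rot,
    List.Forall₂.cons ⟨_, _, _, rfl⟩ hF', hT.qlt, hT.self, hT.le, hT.up, hT.card, hT.edge, ?_⟩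
  have := hT.tri
  simp only [List.forall_mem_cons] at this ⊢
  obtain ⟨⟨j, hj, h1, h2, h3⟩, h4⟩ := this
  exact ⟨⟨j, hj, h2, h3, h1⟩, h4⟩

theorem HS.drop {n A t ts} (h : HS n A (t :: ts)) : HS n A ts := by
  obtain ⟨m, ends, fs, rest, q, B, hA, hP, hF, hT⟩ := h
  obtain ⟨l, fs, -, hF', rfl⟩ := List.forall₂_cons_left_iff.1 hF
  refine ⟨m, ends, fs, l :: rest, q, B, hA, hP.perm ?_, hF', hT.qlt, hT.self, hT.le, hT.up, hT.card, hT.edge, ?_⟩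
  · exact List.perm_middle.symm
  · exact fun t ht => hT.tri t (List.mem_cons_of_mem _ ht)

theorem HS.symm {n A ts} (h : HS n A ts) {i j : ℕ} (hij : A i j) : A j i := by
  obtain ⟨m, ends, fs, rest, q, B, hA, hP, hF, hT⟩ := h
  rw [hA] at hij ⊢
  obtain ⟨e, he, h⟩ := hij
  exact ⟨e, he, h.trans Sym2.eq_swap⟩

theorem HS.tri {n A a b c ts} (h : HS n A ((a, b, c) :: ts)) : A a b ∧ A b c ∧ A c a := by
  obtain ⟨m, ends, fs, rest, q, B, hA, hP, hF, hT⟩ := h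
  obtain ⟨l, fs, ⟨e1, e2, e3, rfl⟩, hF', rfl⟩ := List.forall₂_cons_left_iff.1 hF
  have h1 := hP.ok
  have h2 := hP.bd
  simp only [List.cons_append, List.forall_mem_cons, cor3] at h1 h2
  simp only [hA]
  exact ⟨⟨e1, h2.1.1.2, h1.1.1⟩, ⟨e2, h2.1.2.1.2, h1.1.2.1⟩, ⟨e3, h2.1.2.2.1.2, h1.1.2.2.1⟩⟩

theorem HS.dup {n A a b c ts} (h : HS n A ((a, b, c) :: ts)) :
    ∃ A' : ℕ → ℕ → Prop, (∀ i j, A i j → A' i j) ∧ HS n A' ((a, b, a) :: ts) := by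
  obtain ⟨m, ends, fs, rest, q, B, hA, hP, hF, hT⟩ := h
  obtain ⟨l, fs, ⟨e1, e2, e3, rfl⟩, hF', rfl⟩ := List.forall₂_cons_left_iff.1 hF
  have hP' := hP.dup
  refine ⟨_, ?_, m + 2, _, [(a, e1), (b, m), (a, m + 1)] :: fs, [(a, m + 1)] :: [(b, e2), (c, e3), (a, m)] :: rest,
    q, B, fun i j => Iff.rfl, hP'.perm ?_, List.Forall₂.cons ⟨_, _, _, rfl⟩ hF', hT.qlt, hT.self, hT.le, hT.up, hT.card,
      ?_, ?_⟩
  · intro i j hij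
    obtain ⟨e, he, h⟩ := (hA i j).1 hij
    exact ⟨e, by omega, by simp [he, h]⟩
  · simp only [List.cons_append]
    refine List.Perm.cons _ ?_
    exact (List.perm_append_comm_assoc [[(a, m + 1)], [(b, e2), (c, e3), (a, m)]] fs rest)
  · have h1 := hT.tri (a, b, c) (by simp)
    obtain ⟨j, hj, h1, h2, h3⟩ := h1
    intro e he
    by_cases hem : e < m
    · simp only [hem, if_true]; exact hT.edge e hem
    · refine ⟨j, hj, ?_⟩
      rw [if_neg hem]
      split_ifs
      · simp; exact ⟨h1, h2⟩
      · simp; exact h1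
  · have := hT.tri
    simp only [List.forall_mem_cons] at this ⊢
    obtain ⟨⟨j, hj, h1, h2, h3⟩, h4⟩ := this
    exact ⟨⟨j, hj, h1, h2, h1⟩, h4⟩

theorem HS.stack {n A a b c ts} (h : HS n A ((a, b, c) :: ts)) :
    ∃ A' : ℕ → ℕ → Prop, (∀ i j, A i j → A' i j) ∧
      HS (n + 1) A' ((a, b, n) :: (b, c, n) :: (c, a, n) :: ts) := by
  obtain ⟨m, ends, fs, rest, q, B, hA, hP, hF, hT⟩ := h
  obtain ⟨l, fs, ⟨e1, e2, e3, rfl⟩, hF', rfl⟩ := List.forall₂_cons_left_iff.1 hF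
  have hP' := hP.stack
  have ht := hT.tri (a, b, c) (by simp)
  obtain ⟨j, hj, h1, h2, h3⟩ := ht
  simp only at h1 h2 h3
  have l1 := hT.le j hj a h1
  have l2 := hT.le j hj b h2
  have l3 := hT.le j hj c h3
  refine ⟨_, ?_, m + 3, _, [(a, e1), (b, m + 1), (n, m)] :: [(b, e2), (c, m + 2), (n, m + 1)] ::
        [(c, e3), (a, m), (n, m + 2)] :: fs, rest,
    fun i => if i < n then q i else j, fun i => if i < n then B i else {a, b, c, n}, fun i j => Iff.rfl, hP',
    List.Forall₂.cons ⟨_, _, _, rfl⟩ (List.Forall₂.cons ⟨_, _, _, rfl⟩ (List.Forall₂.cons ⟨_, _, _, rfl⟩ hF')),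
    ?_, ?_, ?_, ?_, ?_, ?_, ?_⟩
  · intro i j hij
    obtain ⟨e, he, h⟩ := (hA i j).1 hij
    exact ⟨e, by omega, by simp [he, h]⟩
  · intro i hi h0
    split_ifs with hin
    · exact hT.qlt i hin h0
    · omega
  · intro i hi
    split_ifs with hin
    · exact hT.self i hin
    · have : i = n := by omega
      simp [this]
  · intro i hi k hk
    split_ifs at hk with hin
    · exact hT.le i hin k hk
    · simp at hk; omega
  · intro i hi h0 k hk hki
    split_ifs at hk with hin
    · have := hT.qlt i hin h0
      simp only [hin, if_true, show q i < n by omega]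
      exact hT.up i hin h0 k hk hki
    · have : i = n := by omega
      subst this
      simp [hki] at hk
      simp [hj]
      rcases hk with rfl | rfl | rfl <;> assumption
  · intro i hi
    split_ifs with hin
    · exact hT.card i hin
    · exact Finset.card_le_four
  · intro e he
    by_cases hem : e < m
    · obtain ⟨i, hi, h⟩ := hT.edge e hem
      refine ⟨i, by omega, ?_⟩
      simp only [hem, hi, if_true]; exact h
    · refine ⟨n, by omega, ?_⟩
      simp only [hem, if_false, lt_irrefl]
      split_ifs <;> simp
  · have h5 := hT.tri
    simp only [List.forall_mem_cons] at h5 ⊢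
    refine ⟨⟨n, by omega, by simp⟩, ⟨n, by omega, by simp⟩, ⟨n, by omega, by simp⟩, ?_⟩
    intro t ht
    obtain ⟨i, hi, h⟩ := h5.2 t ht
    exact ⟨i, by omega, by simpa [hi] using h⟩



/-! ### From the list presentation to planarity and treewidth -/

namespace Multigraph

theorem CWalk.vtx_mod {V E : Type} {G : Multigraph V E} (W : G.CWalk) (i : ℕ) :
    W.vtx (i % W.len) = W.vtx i := by
  have : ∀ k j, W.vtx (j + k * W.len) = W.vtx j := by
    intro k
    induction k with
    | zero => intro j; simp
    | succ k ih => intro j; rw [Nat.succ_mul, ← add_assoc, W.vtx_per, ih]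
  have h := this (i / W.len) (i % W.len)
  rw [Nat.mod_add_div'] at h
  exact h.symm

theorem CWalk.edge_mod {V E : Type} {G : Multigraph V E} (W : G.CWalk) (i : ℕ) :
    W.edge (i % W.len) = W.edge i := by
  have : ∀ k j, W.edge (j + k * W.len) = W.edge j := by
    intro k
    induction k with
    | zero => intro j; simp
    | succ k ih => intro j; rw [Nat.succ_mul, ← add_assoc, W.edge_per, ih]
  have h := this (i / W.len) (i % W.len)
  rw [Nat.mod_add_div'] at h
  exact h.symm

theorem link_of_pred {V E F : Type} {G : Multigraph V E} (bd : F → G.CWalk)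
    (h2 : ∀ e : E, {p : F × ℕ | IsOcc bd e p}.ncard = 2) (v : V)
    (hl : ∀ s : E → Prop, (∀ f i, i < (bd f).len → (bd f).vtx (i + 1) = v →
        (s ((bd f).edge i) ↔ s ((bd f).edge (i + 1)))) →
      ∀ e e', v ∈ G.ends e → v ∈ G.ends e' → (s e ↔ s e')) (c c' : F × ℕ)
    (hc : IsCorner bd v c) (hc' : IsCorner bd v c') :
    Relation.EqvGen (CornerLinked bd v) c c' := by
  have end_corner : ∀ e p, IsOcc bd e p → v ∈ G.ends e → ∃ d, IsCorner bd v d ∧ EndOf bd d p := by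
    rintro e ⟨f, i⟩ ⟨hi, rfl⟩ hv
    rw [(bd f).compat, Sym2.mem_iff] at hv
    rcases hv with rfl | rfl
    · exact ⟨(f, i), ⟨hi, rfl⟩, rfl, Or.inl rfl⟩
    · exact ⟨(f, (i + 1) % (bd f).len), ⟨Nat.mod_lt _ (bd f).len_pos, (bd f).vtx_mod _⟩, rfl, Or.inr rfl⟩
  have end_mem : ∀ e p d, IsOcc bd e p → IsCorner bd v d → EndOf bd d p → v ∈ G.ends e := by
    rintro e ⟨f, i⟩ ⟨f', j⟩ ⟨hi, rfl⟩ ⟨hj, rfl⟩ ⟨h1, h3⟩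
    simp only at h1 h3
    subst h1
    rw [(bd f').compat, Sym2.mem_iff]
    rcases h3 with rfl | rfl
    · exact Or.inl rfl
    · exact Or.inr ((bd f').vtx_mod _)
  have T : ∀ e d d' p p', IsCorner bd v d → IsCorner bd v d' → IsOcc bd e p → IsOcc bd e p' →
      EndOf bd d p → EndOf bd d' p' → Relation.EqvGen (CornerLinked bd v) d d' := by
    intro e d d' p p' hd hd' hp hp' hdp hdp'
    by_cases hpp : p = p'
    · subst hpp
      obtain ⟨x, y, hxy, hS⟩ := Set.ncard_eq_two.1 (h2 e)
      have hx : IsOcc bd e x := by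
        have : x ∈ {p : F × ℕ | IsOcc bd e p} := by rw [hS]; simp
        exact this
      have hy : IsOcc bd e y := by
        have : y ∈ {p : F × ℕ | IsOcc bd e p} := by rw [hS]; simp
        exact this
      obtain ⟨z, hz, hzp⟩ : ∃ z, IsOcc bd e z ∧ z ≠ p := by
        by_cases h : x = p
        · exact ⟨y, hy, fun h' => hxy (h.trans h'.symm)⟩
        · exact ⟨x, hx, h⟩
      obtain ⟨w, hw, hwz⟩ := end_corner e z hz (end_mem e p d hp hd hdp)
      refine Relation.EqvGen.trans _ w _ ?_ ?_
      · exact Relation.EqvGen.rel _ _ ⟨hd, hw, e, p, z, hzp.symm, hp, hz, hdp, hwz⟩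
      · exact Relation.EqvGen.rel _ _ ⟨hw, hd', e, z, p, hzp, hz, hp, hwz, hdp'⟩
    · exact Relation.EqvGen.rel _ _ ⟨hd, hd', e, p, p', hpp, hp, hp', hdp, hdp'⟩
  have key := hl (fun e => ∃ d p, IsCorner bd v d ∧ IsOcc bd e p ∧ EndOf bd d p ∧
    Relation.EqvGen (CornerLinked bd v) c d) (by
      intro f i hi hv
      have hd : IsCorner bd v (f, (i + 1) % (bd f).len) :=
        ⟨Nat.mod_lt _ (bd f).len_pos, by simpa [(bd f).vtx_mod] using hv⟩
      have o1 : IsOcc bd ((bd f).edge i) (f, i) := ⟨hi, rfl⟩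
      have e1 : EndOf bd (f, (i + 1) % (bd f).len) (f, i) := ⟨rfl, Or.inr rfl⟩
      have o2 : IsOcc bd ((bd f).edge (i + 1)) (f, (i + 1) % (bd f).len) :=
        ⟨Nat.mod_lt _ (bd f).len_pos, (bd f).edge_mod _⟩
      have e2 : EndOf bd (f, (i + 1) % (bd f).len) (f, (i + 1) % (bd f).len) := ⟨rfl, Or.inl rfl⟩
      constructor
      · rintro ⟨d, p, h1, h3, h4, h5⟩
        exact ⟨_, _, hd, o2, e2, Relation.EqvGen.trans _ _ _ h5 (T _ _ _ _ _ h1 hd h3 o1 h4 e1)⟩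
      · rintro ⟨d, p, h1, h3, h4, h5⟩
        exact ⟨_, _, hd, o1, e1, Relation.EqvGen.trans _ _ _ h5 (T _ _ _ _ _ h1 hd h3 o2 h4 e2)⟩)
  have oc : IsOcc bd ((bd c.1).edge c.2) c := ⟨hc.1, rfl⟩
  have ec : EndOf bd c c := ⟨rfl, Or.inl rfl⟩
  have oc' : IsOcc bd ((bd c'.1).edge c'.2) c' := ⟨hc'.1, rfl⟩
  have ec' : EndOf bd c' c' := ⟨rfl, Or.inl rfl⟩
  obtain ⟨d, p, h1, h3, h4, h5⟩ := (key ((bd c.1).edge c.2) ((bd c'.1).edge c'.2)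
    (end_mem _ _ _ oc hc ec) (end_mem _ _ _ oc' hc' ec')).1
    ⟨c, c, hc, oc, ec, Relation.EqvGen.refl _⟩
  exact Relation.EqvGen.trans _ _ _ h5 (T _ _ _ _ _ h1 hc' h3 oc' h4 ec')

end Multigraph

theorem mem_cor {α : Type} (l : List α) (hl : 0 < l.length) (i : ℕ) :
    (l[i % l.length]'(Nat.mod_lt _ hl), l[(i + 1) % l.length]'(Nat.mod_lt _ hl)) ∈ cor l := by
  rw [cor, List.mem_iff_getElem]
  refine ⟨i % l.length, by simp [Nat.mod_lt _ hl], ?_⟩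
  simp [List.getElem_rotate]

theorem of_mem_cor {α : Type} (l : List α) {x : α × α} (hx : x ∈ cor l) :
    ∃ (hl : 0 < l.length) (i : ℕ), i < l.length ∧
      x = (l[i % l.length]'(Nat.mod_lt _ hl), l[(i + 1) % l.length]'(Nat.mod_lt _ hl)) := by
  rw [cor, List.mem_iff_getElem] at hx
  obtain ⟨i, hi, rfl⟩ := hx
  simp at hi
  refine ⟨by omega, i, hi, ?_⟩
  simp [List.getElem_rotate, Nat.mod_eq_of_lt hi]

theorem countP_eq_card {α : Type} (p : α → Bool) (l : List α) :
    l.countP p = ((Finset.range l.length).filter (fun i => ∃ h : i < l.length, p l[i] = true)).card := by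
  induction l using List.reverseRecOn with
  | nil => simp
  | append_singleton l x ih =>
    rw [List.countP_append, ih]
    simp only [List.length_append, List.length_singleton, Finset.range_add_one, Finset.filter_insert]
    have h1 : (Finset.range l.length).filter (fun i => ∃ h : i < l.length + 1, p ((l ++ [x])[i]'(by simpa using h)) = true)
      = (Finset.range l.length).filter (fun i => ∃ h : i < l.length, p l[i] = true) := by
      apply Finset.filter_congr
      intro i hi
      rw [Finset.mem_range] at hi
      simp [hi, show i < l.length + 1 by omega]
    rw [h1]
    by_cases hx : p x = true
    · rw [if_pos (by simpa using hx), Finset.card_insert_of_notMem (by simp)]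
      simp [hx]
    · rw [if_neg (by simpa using hx)]
      simp [hx]

theorem HS.planar {n : ℕ} {A : ℕ → ℕ → Prop} {ts : List (ℕ × ℕ × ℕ)} (h : HS n A ts)
    (H : SimpleGraph (Fin n)) (hH : ∀ i j, H.Adj i j → A i j) : IsPlanar H := by
  obtain ⟨m, ends, fs0, rest, q, B, hA, hP, -, -⟩ := h
  generalize fs0 ++ rest = fs at hP
  have hn : 0 < n := by
    by_contra hn
    have : fs = [] := by
      rw [List.eq_nil_iff_forall_not_mem]
      intro l hl
      obtain ⟨d, hd⟩ := List.exists_mem_of_ne_nil l (hP.ne l hl)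
      have := (hP.bd l hl d hd).1
      omega
    have h1 := hP.euler
    rw [this] at h1; simp at h1; omega
  let tf : ℕ → Fin n := fun x => if h : x < n then ⟨x, h⟩ else ⟨0, hn⟩
  have tfv : ∀ x, x < n → (tf x).1 = x := by intro x hx; simp [tf, hx]
  have tfe : ∀ i : Fin n, tf i.1 = i := by intro i; simp [tf]
  let M : Multigraph (Fin n) (Fin m) := ⟨fun e => Sym2.map tf (ends e.1)⟩
  have hlen : ∀ f : Fin fs.length, 0 < (fs[f]).length := by
    intro f; exact List.length_pos_of_ne_nil (hP.ne _ (List.getElem_mem _))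
  let D : Fin fs.length → ℕ → ℕ × ℕ := fun f i => (fs[f])[i % (fs[f]).length]'(Nat.mod_lt _ (hlen f))
  have Dm : ∀ f i, D f i ∈ fs[f] := fun f i => List.getElem_mem _
  have Db : ∀ f i, (D f i).1 < n ∧ (D f i).2 < m := fun f i => hP.bd _ (List.getElem_mem _) _ (Dm f i)
  have Dc : ∀ f i, (D f i, D f (i + 1)) ∈ cor (fs[f]) := fun f i => mem_cor _ (hlen f) i
  let bd : Fin fs.length → M.CWalk := fun f =>
    { len := (fs[f]).length
      len_pos := hlen f
      vtx := fun i => tf (D f i).1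
      edge := fun i => ⟨(D f i).2, (Db f i).2⟩
      vtx_per := fun i => by simp [D]
      edge_per := fun i => by simp [D]
      compat := fun i => by
        simp only [M]
        rw [hP.ok _ (List.getElem_mem _) _ (Dc f i)]
        rfl }
  have h2 : ∀ e : Fin m, {p : Fin fs.length × ℕ | Multigraph.IsOcc bd e p}.ncard = 2 := by
    intro e
    rw [← hP.cnt e.1 e.2, ← Fin.sum_univ_fun_getElem]
    have : {p : Fin fs.length × ℕ | Multigraph.IsOcc bd e p} =
      ↑((Finset.univ.sigma (fun f : Fin fs.length => (Finset.range (fs[f]).length).filter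
        (fun i => ∃ h : i < (fs[f]).length, decide ((fs[f])[i].2 = e.1) = true))).map
        (Equiv.sigmaEquivProd (Fin fs.length) ℕ).toEmbedding) := by
      ext ⟨f, i⟩
      by_cases hi : i < (fs[f]).length
      · have hi' : i < (fs[f.1]).length := hi
        simp [Multigraph.IsOcc, bd, D, Fin.ext_iff, hi', Nat.mod_eq_of_lt hi']
        constructor
        · exact fun h => ⟨f, ⟨hi', h⟩, rfl⟩
        · rintro ⟨a, ⟨h1, h3⟩, h4⟩
          obtain rfl := Fin.ext h4
          exact h3
      · have hi' : ¬ i < (fs[f.1]).length := hi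
        simp [Multigraph.IsOcc, bd, hi']
    rw [this, Set.ncard_coe_finset, Finset.card_map, Finset.card_sigma]
    refine Finset.sum_congr rfl (fun f _ => ?_)
    exact (countP_eq_card (fun d => decide (d.2 = e.1)) (fs[f])).symm
  have hends : ∀ e : Fin m, ∃ a b, a < n ∧ b < n ∧ ends e.1 = s(a, b) := by
    intro e
    have h3 := h2 e
    obtain ⟨⟨f, i⟩, h⟩ := Set.nonempty_of_ncard_ne_zero (s := {p : Fin fs.length × ℕ | Multigraph.IsOcc bd e p}) (by omega)
    obtain ⟨h4, rfl⟩ := h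
    exact ⟨_, _, (Db f i).1, (Db f (i + 1)).1, hP.ok _ (List.getElem_mem _) _ (Dc f i)⟩
  have hMe : ∀ (e : Fin m) (v : Fin n), v ∈ M.ends e ↔ v.1 ∈ ends e.1 := by
    intro e v
    obtain ⟨a, b, ha, hb, h⟩ := hends e
    simp [M, h, Fin.ext_iff, tfv a ha, tfv b hb]
  have hconn : M.simple.Connected := by
    have : Nonempty (Fin n) := ⟨⟨0, hn⟩⟩
    have : ∀ k (hk : k < n), M.simple.Reachable ⟨k, hk⟩ ⟨0, hn⟩ := by
      intro k
      induction k using Nat.strong_induction_on with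
      | _ k ih =>
        intro hk
        by_cases h0 : k = 0
        · subst h0; exact SimpleGraph.Reachable.refl _
        · obtain ⟨u, hu, e, he, hee⟩ := hP.conn k hk (by omega)
          refine SimpleGraph.Reachable.trans (SimpleGraph.Adj.reachable ?_) (ih u hu (by omega))
          refine ⟨by simp [Fin.ext_iff]; omega, ⟨e, he⟩, ?_⟩
          simp only [M, hee, Sym2.map_mk]
          rw [Sym2.eq_swap]
          congr 2
          · simp [tf, hk]
          · simp [tf, show u < n by omega]
    refine SimpleGraph.Connected.mk ?_
    intro x y
    exact (this x.1 x.2).trans (this y.1 y.2).symm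
  let emb : M.Embedding (Fin fs.length) :=
    { boundary := bd
      conn := hconn
      edge_twice := h2
      link_conn := by
        intro v c c' hc hc'
        refine Multigraph.link_of_pred bd h2 v ?_ c c' hc hc'
        intro s hs e e' he he'
        have := hP.link v.1 v.2 (fun k => ∃ h : k < m, s ⟨k, h⟩) (by
          intro l hl x hx hxv
          obtain ⟨f, hf, rfl⟩ := List.getElem_of_mem hl
          obtain ⟨hl', i, hi, rfl⟩ := of_mem_cor _ hx
          have := hs ⟨f, hf⟩ i hi (by rw [← tfe v, ← hxv]; rfl)
          have b1 := (Db ⟨f, hf⟩ i).2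
          have b2 := (Db ⟨f, hf⟩ (i + 1)).2
          have l1 : (∃ h, s ⟨(D ⟨f, hf⟩ i).2, h⟩) ↔ s ⟨(D ⟨f, hf⟩ i).2, b1⟩ := ⟨fun h => h.2, fun h => ⟨b1, h⟩⟩
          have l2 : (∃ h, s ⟨(D ⟨f, hf⟩ (i + 1)).2, h⟩) ↔ s ⟨(D ⟨f, hf⟩ (i + 1)).2, b2⟩ := ⟨fun h => h.2, fun h => ⟨b2, h⟩⟩
          exact l1.trans (this.trans l2.symm)) e.1 e.2 e'.1 e'.2 ((hMe _ _).1 he) ((hMe _ _).1 he')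
        simpa using this }
  refine ⟨Fin n, Fin m, Fin fs.length, inferInstance, inferInstance, inferInstance, M, emb, ?_, ?_⟩
  · have := hP.euler
    simp [Multigraph.Embedding.eulerGenus]; omega
  · refine ⟨⟨id, ?_⟩, Function.injective_id⟩
    intro i j hij
    obtain ⟨e, he, hee⟩ := (hA i j).1 (hH i j hij)
    refine ⟨hij.ne, ⟨e, he⟩, ?_⟩
    simp [M, hee, tfe]

theorem HS.treewidth {n : ℕ} {A : ℕ → ℕ → Prop} {ts : List (ℕ × ℕ × ℕ)} (h : HS n A ts) (hn : 0 < n)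
    (H : SimpleGraph (Fin n)) (hH : ∀ i j, H.Adj i j → A i j) : TreewidthLE H 3 := by
  obtain ⟨m, ends, fs0, rest, q, B, hA, -, -, hT⟩ := h
  let T : SimpleGraph (Fin n) :=
    { Adj := fun i j => i ≠ j ∧ ((0 < j.1 ∧ q j.1 = i.1) ∨ (0 < i.1 ∧ q i.1 = j.1))
      symm := ⟨fun i j h => ⟨h.1.symm, h.2.symm⟩⟩
      loopless := ⟨fun i h => h.1 rfl⟩ }
  have : Nonempty (Fin n) := ⟨⟨0, hn⟩⟩
  have tadj : ∀ k (hk : k < n) (h0 : 0 < k), T.Adj ⟨k, hk⟩ ⟨q k, (hT.qlt k hk h0).trans hk⟩ := by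
    intro k hk h0
    have := hT.qlt k hk h0
    exact ⟨by simp [Fin.ext_iff]; omega, Or.inr ⟨h0, rfl⟩⟩
  have hconn : T.Connected := by
    have : ∀ k (hk : k < n), T.Reachable ⟨k, hk⟩ ⟨0, hn⟩ := by
      intro k
      induction k using Nat.strong_induction_on with
      | _ k ih =>
        intro hk
        by_cases h0 : k = 0
        · subst h0; exact SimpleGraph.Reachable.refl _
        · exact (tadj k hk (by omega)).reachable.trans (ih _ (hT.qlt k hk (by omega)) _)
    refine SimpleGraph.Connected.mk ?_
    intro x y
    exact (this x.1 x.2).trans (this y.1 y.2).symm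
  refine ⟨Fin n, T, fun i => {x | x.1 ∈ B i.1}, ?_, ?_, ?_, ?_, ?_⟩
  · rw [SimpleGraph.isTree_iff_connected_and_card]
    refine ⟨hconn, le_antisymm ?_ ?_⟩
    · have hsub : T.edgeSet ⊆ ↑((Finset.univ.erase (⟨0, hn⟩ : Fin n)).image
          (fun j : Fin n => if h0 : 0 < j.1 then s(j, ⟨q j.1, (hT.qlt j.1 j.2 h0).trans j.2⟩) else s(j, j))) := by
        intro e he
        induction e using Sym2.inductionOn with
        | _ x y =>
          rw [SimpleGraph.mem_edgeSet] at he
          obtain ⟨hne, ⟨h0, hq⟩ | ⟨h0, hq⟩⟩ := he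
          · simp only [Finset.coe_image, Set.mem_image]
            refine ⟨y, by simp [Fin.ext_iff]; omega, ?_⟩
            rw [dif_pos h0, Sym2.eq_swap]
            simp only [hq]
          · simp only [Finset.coe_image, Set.mem_image]
            refine ⟨x, by simp [Fin.ext_iff]; omega, ?_⟩
            rw [dif_pos h0]
            simp only [hq]
      have h1 := Set.ncard_le_ncard hsub
      rw [Set.ncard_coe_finset] at h1
      have h3 : _ ≤ _ := Finset.card_image_le (s := Finset.univ.erase (⟨0, hn⟩ : Fin n)) (f := (fun j : Fin n => if h0 : 0 < j.1 then s(j, ⟨q j.1, (hT.qlt j.1 j.2 h0).trans j.2⟩) else s(j, j)))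
      rw [Finset.card_erase_of_mem (Finset.mem_univ _), Finset.card_univ, Fintype.card_fin] at h3
      have h4 : Nat.card T.edgeSet = T.edgeSet.ncard := rfl
      rw [h4, Nat.card_eq_fintype_card, Fintype.card_fin]
      omega
    · exact hconn.card_vert_le_card_edgeSet_add_one
  · exact fun v => ⟨v, hT.self v.1 v.2⟩
  · intro u v huv
    obtain ⟨e, he, hee⟩ := (hA u v).1 (hH u v huv)
    obtain ⟨j, hj, h⟩ := hT.edge e he
    rw [hee] at h
    exact ⟨⟨j, hj⟩, h _ (by simp), h _ (by simp)⟩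
  · intro v
    have hv : v ∈ {i : Fin n | v.1 ∈ B i.1} := hT.self v.1 v.2
    have : ∀ k (hk : k < n) (hkv : v.1 ∈ B k),
        (T.induce {i : Fin n | v.1 ∈ B i.1}).Reachable ⟨⟨k, hk⟩, hkv⟩ ⟨v, hv⟩ := by
      intro k
      induction k using Nat.strong_induction_on with
      | _ k ih =>
        intro hk hkv
        by_cases h0 : v.1 = k
        · subst h0; exact SimpleGraph.Reachable.refl _
        · have hle := hT.le k hk _ hkv
          have hk0 : 0 < k := by omega
          refine SimpleGraph.Reachable.trans (SimpleGraph.Adj.reachable ?_)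
            (ih (q k) (hT.qlt k hk hk0) ((hT.qlt k hk hk0).trans hk) (hT.up k hk hk0 _ hkv h0))
          exact tadj k hk hk0
    refine (SimpleGraph.connected_iff _).2 ⟨?_, ⟨⟨v, hv⟩⟩⟩
    intro x y
    exact (this x.1.1 x.1.2 x.2).trans (this y.1.1 y.1.2 y.2).symm
  · intro i
    have h1 : Set.encard ((fun x : Fin n => x.1) '' {x : Fin n | x.1 ∈ B i.1}) ≤ Set.encard (↑(B i.1) : Set ℕ) := by
      apply Set.encard_le_encard
      rintro _ ⟨x, hx, rfl⟩
      exact hx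
    rw [(Fin.val_injective).encard_image, Set.encard_coe_eq_coe_finsetCard] at h1
    refine h1.trans ?_
    have := hT.card i.1 i.2
    exact_mod_cast this



/-! ### Cyclic patterns in lists -/

/-- `Q` holds for every four-element subsequence of `L`. -/
def C4 {P : Type} (Q : P → P → P → P → Prop) (L : List P) : Prop :=
  ∀ a b c d, List.Sublist [a, b, c, d] L → Q a b c d

theorem C4.sub {P : Type} {Q : P → P → P → P → Prop} {L L' : List P} (h : C4 Q L)
    (hs : List.Sublist L' L) : C4 Q L' :=
  fun a b c d h' => h a b c d (h'.trans hs)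

theorem C4.rot {P : Type} {Q : P → P → P → P → Prop} (hQ : ∀ a b c d, Q a b c d → Q b c d a)
    {L1 L2 : List P} (h : C4 Q (L1 ++ L2)) : C4 Q (L2 ++ L1) := by
  intro a b c d hs
  rw [List.sublist_append_iff] at hs
  obtain ⟨l1, l2, he, h1, h2⟩ := hs
  have h3 : List.Sublist (l2 ++ l1) (L1 ++ L2) := h2.append h1
  match l1, he with
  | [], he =>
    simp only [List.nil_append] at he; subst he
    exact h _ _ _ _ (by simpa using h3)
  | [x], he =>
    simp only [List.cons_append, List.nil_append, List.cons.injEq] at he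
    obtain ⟨rfl, rfl⟩ := he
    exact hQ _ _ _ _ (hQ _ _ _ _ (hQ _ _ _ _ (h _ _ _ _ (by simpa using h3))))
  | [x, y], he =>
    simp only [List.cons_append, List.nil_append, List.cons.injEq] at he
    obtain ⟨rfl, rfl, rfl⟩ := he
    exact hQ _ _ _ _ (hQ _ _ _ _ (h _ _ _ _ (by simpa using h3)))
  | [x, y, z], he =>
    simp only [List.cons_append, List.nil_append, List.cons.injEq] at he
    obtain ⟨rfl, rfl, rfl, rfl⟩ := he
    exact hQ _ _ _ _ (h _ _ _ _ (by simpa using h3))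
  | [x, y, z, w], he =>
    simp only [List.cons_append, List.nil_append, List.cons.injEq] at he
    obtain ⟨rfl, rfl, rfl, rfl, rfl⟩ := he
    exact h _ _ _ _ (by simpa using h3)
  | x :: y :: z :: w :: t :: l, he => simp at he

/-- The relation `K` has no crossing pairs. -/
def NC {P : Type} (K : P → P → Prop) (L : List P) : Prop :=
  C4 (fun a b c d => ¬ (K a c ∧ K b d)) L

/-- The set `S` is an interval of the cyclic list. -/
def IV {P : Type} (S : P → Prop) (L : List P) : Prop :=
  C4 (fun a b c d => ¬ (S a ∧ ¬ S b ∧ S c ∧ ¬ S d) ∧ ¬ (¬ S a ∧ S b ∧ ¬ S c ∧ S d)) L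

theorem NC.rot {P : Type} {K : P → P → Prop} (hK : ∀ p q, K p q → K q p) {L1 L2 : List P}
    (h : NC K (L1 ++ L2)) : NC K (L2 ++ L1) :=
  C4.rot (fun _ _ _ _ h1 h2 => h1 ⟨hK _ _ h2.2, h2.1⟩) h

theorem IV.rot {P : Type} {S : P → Prop} {L1 L2 : List P}
    (h : IV S (L1 ++ L2)) : IV S (L2 ++ L1) :=
  C4.rot (fun _ _ _ _ h1 => ⟨fun h2 => h1.2 ⟨h2.2.2.2, h2.1, h2.2.1, h2.2.2.1⟩,
    fun h2 => h1.1 ⟨h2.2.2.2, h2.1, h2.2.1, h2.2.2.1⟩⟩) h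

theorem split_mid {P : Type} {R1 R2 S T : List P} {x : P} (h : R1 ++ x :: R2 = S ++ T) :
    (∃ S', S = R1 ++ x :: S' ∧ R2 = S' ++ T) ∨ (∃ T', T = T' ++ x :: R2 ∧ R1 = S ++ T') := by
  rw [List.append_eq_append_iff] at h
  rcases h with ⟨as, h1, h2⟩ | ⟨bs, h1, h2⟩
  · cases as with
    | nil => simp at h1 h2; subst h1; right; exact ⟨[], by simp [h2], by simp⟩
    | cons y as =>
      simp only [List.cons_append, List.cons.injEq] at h2
      left; exact ⟨as, by rw [h1, h2.1], h2.2⟩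
  · right; exact ⟨bs, h2, h1⟩

theorem last_adj {P : Type} (k : P → Prop) (R : List P) (hR : R ≠ []) :
    ∃ R1 x R2, R = R1 ++ x :: R2 ∧ (k x ∨ R1 = []) ∧ ∀ z ∈ R2, ¬ k z := by
  induction R with
  | nil => exact absurd rfl hR
  | cons h t ih =>
    by_cases ht : t = []
    · exact ⟨[], h, [], by simp [ht], Or.inr rfl, by simp⟩
    · obtain ⟨R1, x, R2, h1, h2, h3⟩ := ih ht
      by_cases hx : k x
      · exact ⟨h :: R1, x, R2, by simp [h1], Or.inl hx, h3⟩
      · have : R1 = [] := h2.resolve_left hx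
        subst this
        refine ⟨[], h, t, rfl, Or.inr rfl, ?_⟩
        rw [h1]; simp; exact ⟨hx, h3⟩

/-- No `K`-pair between two lists. -/
def noK {P : Type} (K : P → P → Prop) (L M : List P) : Prop := ∀ p ∈ L, ∀ q ∈ M, ¬ K p q

theorem sub4 {P : Type} {a b c d : P} {L1 L2 L3 : List P} (hb : b ∈ L1) (hd : d ∈ L2) :
    List.Sublist [a, b, c, d] (a :: L1 ++ c :: L2 ++ L3) := by
  have h1 : List.Sublist [b] L1 := List.singleton_sublist.2 hb
  have h2 : List.Sublist [d] L2 := List.singleton_sublist.2 hd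
  have := ((h1.cons_cons a).append (h2.cons_cons c)).append (List.nil_sublist L3)
  simpa using this

theorem lemF {P : Type} (K : P → P → Prop) (hK : ∀ p q, K p q → K q p) (N : ℕ) :
    ∀ (A1 : List P) (xa : P) (A2 B1 : List P) (xb : P) (B2 C : List P), A1.length + B2.length < N →
    C ≠ [] → NC K ((A1 ++ xa :: A2) ++ (B1 ++ xb :: B2) ++ C) → noK K (A2 ++ B1) (B2 ++ C ++ A1) →
    ∃ A1' xa' A2' B1' xb' B2' C1 xc C2, A1' ++ xa' :: A2' = A1 ++ xa :: A2 ∧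
      B1' ++ xb' :: B2' = B1 ++ xb :: B2 ∧ C1 ++ xc :: C2 = C ∧
      noK K (A2' ++ B1') (B2' ++ C1 ++ xc :: C2 ++ A1') ∧
      noK K (B2' ++ C1) (C2 ++ A1' ++ xa' :: A2' ++ B1') ∧
      noK K (C2 ++ A1') (A2' ++ B1' ++ xb' :: B2' ++ C1) := by
  induction N with
  | zero => intro A1 xa A2 B1 xb B2 C hN; omega
  | succ N ih =>
    intro A1 xa A2 B1 xb B2 C hN hC hNC h0
    obtain ⟨R1, x, R2, hR, h2, h3⟩ := last_adj (K xb) (B2 ++ C ++ A1) (by simp [hC])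
    have hr : NC K (xb :: R1 ++ x :: (R2 ++ xa :: A2 ++ B1) ++ []) := by
      have := NC.rot hK (L1 := A1 ++ xa :: A2 ++ B1) (L2 := xb :: B2 ++ C) (by simpa using hNC)
      have e : xb :: R1 ++ x :: (R2 ++ xa :: A2 ++ B1) ++ [] = xb :: (R1 ++ x :: R2) ++ xa :: A2 ++ B1 := by simp
      rw [e, ← hR]
      simpa using this
    have k1 : noK K R1 (R2 ++ xa :: A2 ++ B1) := by
      intro p hp q hq hpq
      rcases h2 with h2 | h2
      · exact hr xb p x q (sub4 hp hq) ⟨h2, hpq⟩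
      · simp [h2] at hp
    have k2 : noK K (A2 ++ B1) (R1 ++ x :: R2) := by rw [← hR]; exact h0
    have hR' := hR.symm
    rw [List.append_assoc] at hR'
    rcases split_mid hR' with ⟨S', h4, h5⟩ | ⟨T', h4, h5⟩
    · obtain ⟨A1', xa', A2', B1', xb', B2', C1, xc, C2, e1, e2, e3, e4⟩ :=
        ih A1 xa A2 (B1 ++ xb :: R1) x S' C (by rw [h4] at hN; simp at hN; omega) hC
          (by rw [h4] at hNC; simpa using hNC) (by
            have : S' ++ C ++ A1 = R2 := by simp [h5]
            rw [this]
            intro p hp q hq hpq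
            simp only [List.mem_append, List.mem_cons] at hp
            rcases hp with hp | hp | rfl | hp
            · exact k2 p (by simp [hp]) q (by simp [hq]) hpq
            · exact k2 p (by simp [hp]) q (by simp [hq]) hpq
            · exact h3 q hq hpq
            · exact k1 p hp q (by simp [hq]) hpq)
      exact ⟨A1', xa', A2', B1', xb', B2', C1, xc, C2, e1, by rw [e2, h4]; simp, e3, e4⟩
    · rcases split_mid h4.symm with ⟨C2, h6, h7⟩ | ⟨T'', h6, h7⟩
      · subst h5 h6 h7
        refine ⟨A1, xa, A2, B1, xb, B2, T', x, C2, rfl, rfl, rfl, by simpa [noK] using k2, by simpa [noK] using k1, ?_⟩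
        intro p hp q hq hpq
        simp only [List.mem_append, List.mem_cons] at hq
        rcases hq with ((hq | hq) | (rfl | hq)) | hq
        · exact k2 q (by simp [hq]) p (by simp at hp ⊢; tauto) (hK _ _ hpq)
        · exact k2 q (by simp [hq]) p (by simp at hp ⊢; tauto) (hK _ _ hpq)
        · exact h3 p hp (hK _ _ hpq)
        · exact k1 q (by simp [hq]) p (by simp at hp ⊢; tauto) (hK _ _ hpq)
        · exact k1 q (by simp [hq]) p (by simp at hp ⊢; tauto) (hK _ _ hpq)
      · obtain ⟨A1', xa', A2', B1', xb', B2', C1, xc, C2, e1, e2, e3, e4⟩ :=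
          ih T'' x (R2 ++ xa :: A2) B1 xb B2 C (by rw [h6] at hN; simp at hN; omega) hC
          (by rw [h6] at hNC; simpa using hNC) (by
            have : B2 ++ C ++ T'' = R1 := by simp [h5, h7]
            rw [this]
            intro p hp q hq hpq
            exact k1 q hq p (by simpa using hp) (hK _ _ hpq))
        exact ⟨A1', xa', A2', B1', xb', B2', C1, xc, C2, by rw [e1, h6]; simp, e2, e3, e4⟩

theorem split3 {P : Type} (u : P → Prop) (l : List P)
    (h : ∀ m y z, List.Sublist [m, y, z] l → ¬ (¬ u m ∧ u y ∧ ¬ u z)) :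
    ∃ T1 M T2, l = T1 ++ M ++ T2 ∧ (∀ p ∈ T1, u p) ∧ (∀ p ∈ M, ¬ u p) ∧ (∀ p ∈ T2, u p) := by
  induction l with
  | nil => exact ⟨[], [], [], by simp⟩
  | cons x t ih =>
    obtain ⟨T1, M, T2, h1, h2, h3, h4⟩ := ih (fun m y z hs => h m y z (hs.trans (List.sublist_cons_self _ _)))
    by_cases hx : u x
    · exact ⟨x :: T1, M, T2, by simp [h1], by simpa [hx] using h2, h3, h4⟩
    · rcases M with _ | ⟨z, M⟩
      · refine ⟨[], [x], t, by simp, by simp, by simpa using hx, ?_⟩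
        intro p hp
        rw [h1] at hp
        simp at hp
        rcases hp with hp | hp
        · exact h2 p hp
        · exact h4 p hp
      · rcases T1 with _ | ⟨y, T1⟩
        · exact ⟨[], x :: z :: M, T2, by simp [h1], by simp, by simp at h3 ⊢; exact ⟨hx, h3⟩, h4⟩
        · exfalso
          refine h x y z ?_ ⟨hx, h2 y (by simp), h3 z (by simp)⟩
          rw [h1]
          simp



/-! ### Rooted trees -/

/-- A rooted tree given by a parent function and depths. -/
structure RT (V : Type) where
  r : V
  par : V → V
  dep : V → ℕ
  par_r : par r = r
  dep_par : ∀ v, v ≠ r → dep (par v) + 1 = dep v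

namespace RT

variable {V : Type} (T : RT V)

/-- `w` is an ancestor of `v`. -/
def Anc (w v : V) : Prop := ∃ k, T.par^[k] v = w

theorem anc_refl (v : V) : T.Anc v v := ⟨0, rfl⟩

theorem anc_par {w v : V} (h : T.Anc w (T.par v)) : T.Anc w v := by
  obtain ⟨k, hk⟩ := h
  exact ⟨k + 1, by rw [Function.iterate_succ_apply, hk]⟩

theorem anc_cases {w v : V} (h : T.Anc w v) : w = v ∨ T.Anc w (T.par v) := by
  obtain ⟨k, hk⟩ := h
  cases k with
  | zero => left; exact hk.symm
  | succ k => right; exact ⟨k, by rw [← hk, Function.iterate_succ_apply]⟩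

theorem par_anc {w v : V} (h : T.Anc w v) : T.Anc (T.par w) v := by
  obtain ⟨k, hk⟩ := h
  exact ⟨k + 1, by rw [Function.iterate_succ_apply', hk]⟩

theorem anc_trans {u w v : V} (h : T.Anc u w) (h' : T.Anc w v) : T.Anc u v := by
  obtain ⟨k, hk⟩ := h
  obtain ⟨l, hl⟩ := h'
  exact ⟨k + l, by rw [Function.iterate_add_apply, hl, hk]⟩

theorem closed {S : V → Prop} (hS : ∀ v, S v → S (T.par v)) {w v : V} (h : T.Anc w v) (hv : S v) : S w := by
  obtain ⟨k, rfl⟩ := h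
  induction k with
  | zero => exact hv
  | succ k ih => rw [Function.iterate_succ_apply']; exact hS _ ih

theorem anc_r {w : V} (h : T.Anc w T.r) : w = T.r :=
  T.closed (S := fun v => v = T.r) (fun v hv => by rw [hv, T.par_r]) h rfl

theorem anc_dep {w v : V} (h : T.Anc w v) : T.dep w ≤ T.dep v := by
  refine T.closed (S := fun u => T.dep u ≤ T.dep v) (fun u hu => ?_) h le_rfl
  by_cases hr : u = T.r
  · subst hr; rw [T.par_r]; exact hu
  · have := T.dep_par u hr; omega

theorem anc_eq {w v : V} (h : T.Anc w v) (hd : T.dep w = T.dep v) : w = v := by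
  rcases T.anc_cases h with h1 | h1
  · exact h1
  · by_cases hr : v = T.r
    · subst hr; exact T.anc_r h
    · have := T.dep_par v hr
      have := T.anc_dep h1
      omega

theorem anc_uniq {w w' v : V} (h : T.Anc w v) (h' : T.Anc w' v) (hd : T.dep w = T.dep w') : w = w' := by
  obtain ⟨k, hk⟩ := h
  obtain ⟨l, hl⟩ := h'
  rcases le_total k l with hkl | hkl
  · have : T.Anc w' w := ⟨l - k, by rw [← hk, ← Function.iterate_add_apply, Nat.sub_add_cancel hkl, hl]⟩
    exact (T.anc_eq this hd.symm).symm
  · have : T.Anc w w' := ⟨k - l, by rw [← hl, ← Function.iterate_add_apply, Nat.sub_add_cancel hkl, hk]⟩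
    exact T.anc_eq this hd

end RT

/-! ### The decomposition procedure -/

section Proc

variable {V P : Type} (T : RT V) (lam : P → V) (K : P → P → Prop) (mm : ℕ)

/-- The global state. -/
structure St (n : ℕ) (A : ℕ → ℕ → Prop) (asg : V → Prop) (col : V → ℕ) (ts : List (ℕ × ℕ × ℕ)) : Prop where
  hs : HS n A ts
  rt : asg T.r
  cl : ∀ v, asg v → asg (T.par v)
  cp : ∀ v, ¬ asg v → col v = col (T.par v)
  lt : ∀ v, col v < n
  cnt : ∀ c d, {v | asg v ∧ col v = c ∧ T.dep v = d}.ncard ≤ mm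

/-- A good region. -/
structure GR (asg : V → Prop) (col : V → ℕ) (X : List P) (a : ℕ) (Y : List P) (b : ℕ)
    (Z : List P) (c : ℕ) : Prop where
  nd : (X ++ Y ++ Z).Nodup
  nc : NC K (X ++ Y ++ Z)
  iv : ∀ w, ¬ asg w → IV (fun p => T.Anc w (lam p)) (X ++ Y ++ Z)
  ca : ∀ p ∈ X, col (lam p) = a
  cb : ∀ p ∈ Y, col (lam p) = b
  cc : ∀ p ∈ Z, col (lam p) = c

/-- What processing a region achieves. -/
structure Post (A A' : ℕ → ℕ → Prop) (asg asg' : V → Prop) (col col' : V → ℕ) (S : List P) : Prop where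
  mA : ∀ i j, A i j → A' i j
  mono : ∀ v, asg v → asg' v
  fr : ∀ v, (∀ w, T.Anc w v → asg' w → asg w) → col' v = col v
  new : ∀ w, asg' w → ¬ asg w → ∃ p ∈ S, T.Anc w (lam p)
  all : ∀ p ∈ S, asg' (lam p)
  ed : ∀ p ∈ S, ∀ q ∈ S, K p q → col' (lam p) = col' (lam q) ∨ A' (col' (lam p)) (col' (lam q))

variable {T lam K mm}

theorem GR.rot (hK : ∀ p q, K p q → K q p) {asg : V → Prop} {col : V → ℕ} {X Y Z : List P} {a b c : ℕ}
    (h : GR T lam K asg col X a Y b Z c) : GR T lam K asg col Y b Z c X a where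
  nd := by
    have := h.nd
    rw [List.append_assoc] at this
    exact (List.nodup_append_comm).1 this
  nc := NC.rot hK (by have := h.nc; rw [List.append_assoc] at this; exact this)
  iv := fun w hw => IV.rot (by have := h.iv w hw; rw [List.append_assoc] at this; exact this)
  ca := h.cb
  cb := h.cc
  cc := h.ca

theorem St.rot {n A asg col a b c ts} (h : St T mm n A asg col ((a, b, c) :: ts)) :
    St T mm n A asg col ((b, c, a) :: ts) where
  hs := h.hs.rot
  rt := h.rt
  cl := h.cl
  cp := h.cp
  lt := h.lt
  cnt := h.cnt

theorem St.dup {n A asg col a b c ts} (h : St T mm n A asg col ((a, b, c) :: ts)) :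
    ∃ A' : ℕ → ℕ → Prop, (∀ i j, A i j → A' i j) ∧ St T mm n A' asg col ((a, b, a) :: ts) := by
  obtain ⟨A', h1, h2⟩ := h.hs.dup
  exact ⟨A', h1, h2, h.rt, h.cl, h.cp, h.lt, h.cnt⟩

/-- The goal of processing a region. -/
def Done (T : RT V) (lam : P → V) (K : P → P → Prop) (mm : ℕ) (A : ℕ → ℕ → Prop) (asg : V → Prop)
    (col : V → ℕ) (ts : List (ℕ × ℕ × ℕ)) (S : List P) : Prop :=
  ∃ n' A' asg' col', St T mm n' A' asg' col' ts ∧ Post T lam K A A' asg asg' col col' S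

theorem Done.mono {A A1 : ℕ → ℕ → Prop} {asg : V → Prop} {col : V → ℕ} {ts : List (ℕ × ℕ × ℕ)}
    {S S' : List P} (h : Done T lam K mm A1 asg col ts S) (hA : ∀ i j, A i j → A1 i j)
    (hS : ∀ p, p ∈ S ↔ p ∈ S') : Done T lam K mm A asg col ts S' := by
  obtain ⟨n', A', asg', col', h1, h2⟩ := h
  refine ⟨n', A', asg', col', h1, ⟨fun i j hij => h2.mA i j (hA i j hij), h2.mono, h2.fr, ?_, ?_, ?_⟩⟩
  · intro w hw hw'
    obtain ⟨p, hp, h⟩ := h2.new w hw hw'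
    exact ⟨p, (hS p).1 hp, h⟩
  · exact fun p hp => h2.all p ((hS p).2 hp)
  · exact fun p hp q hq => h2.ed p ((hS p).2 hp) q ((hS q).2 hq)

theorem done_of_asg {n A asg col a b c ts} {X Y Z : List P} (h : St T mm n A asg col ((a, b, c) :: ts))
    (hg : GR T lam K asg col X a Y b Z c) (hall : ∀ p ∈ X ++ Y ++ Z, asg (lam p)) :
    Done T lam K mm A asg col ts (X ++ Y ++ Z) := by
  refine ⟨n, A, asg, col, ⟨h.hs.drop, h.rt, h.cl, h.cp, h.lt, h.cnt⟩, fun _ _ h => h, fun _ h => h, fun _ _ => rfl,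
    fun w hw hw' => absurd hw hw', hall, ?_⟩
  intro p hp q hq _
  obtain ⟨t1, t2, t3⟩ := h.hs.tri
  simp only [List.mem_append] at hp hq
  rcases hp with (hp | hp) | hp <;> rcases hq with (hq | hq) | hq <;>
    simp only [hg.ca _ , hg.cb _ , hg.cc _ , hp, hq] <;>
    first
    | exact Or.inl rfl
    | exact Or.inl trivial
    | exact Or.inr t1
    | exact Or.inr t2
    | exact Or.inr t3
    | exact Or.inr (h.hs.symm t1)
    | exact Or.inr (h.hs.symm t2)
    | exact Or.inr (h.hs.symm t3)

/-- The set of new vertices. -/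
def Wn (T : RT V) (asg : V → Prop) (x y z w : V) : Prop :=
  ¬ asg w ∧ (T.Anc w x ∨ T.Anc w y ∨ T.Anc w z)

/-- Having a new ancestor. -/
def Un (T : RT V) (asg : V → Prop) (x y z v : V) : Prop := ∃ w, Wn T asg x y z w ∧ T.Anc w v

open Classical in
/-- The new colouring. -/
noncomputable def Cn (T : RT V) (asg : V → Prop) (col : V → ℕ) (n : ℕ) (x y z v : V) : ℕ :=
  if Un T asg x y z v then n else col v

theorem Un.not_asg {asg : V → Prop} (hcl : ∀ v, asg v → asg (T.par v)) {x y z v : V}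
    (h : Un T asg x y z v) : ¬ asg v := by
  obtain ⟨w, hw, hv⟩ := h
  exact fun hv' => hw.1 (T.closed hcl hv hv')

theorem St.stack [Finite V] (hmm : 3 ≤ mm) {n A asg col a b c ts} (h : St T mm n A asg col ((a, b, c) :: ts)) (x y z : V) :
    ∃ A' : ℕ → ℕ → Prop, (∀ i j, A i j → A' i j) ∧
      St T mm (n + 1) A' (fun v => asg v ∨ Wn T asg x y z v) (Cn T asg col n x y z)
        ((a, b, n) :: (b, c, n) :: (c, a, n) :: ts) := by
  obtain ⟨A', h1, h2⟩ := h.hs.stack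
  refine ⟨A', h1, h2, Or.inl h.rt, ?_, ?_, ?_, ?_⟩
  · rintro v (hv | hv)
    · exact Or.inl (h.cl v hv)
    · by_cases hp : asg (T.par v)
      · exact Or.inl hp
      · exact Or.inr ⟨hp, hv.2.imp (T.par_anc) (Or.imp T.par_anc T.par_anc)⟩
  · intro v hv
    push Not at hv
    have : Un T asg x y z v ↔ Un T asg x y z (T.par v) := by
      constructor
      · rintro ⟨w, hw, hwv⟩
        rcases T.anc_cases hwv with rfl | h'
        · exact absurd hw hv.2
        · exact ⟨w, hw, h'⟩
      · rintro ⟨w, hw, hwv⟩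
        exact ⟨w, hw, T.anc_par hwv⟩
    by_cases hu : Un T asg x y z v
    · rw [Cn, Cn, if_pos hu, if_pos (this.1 hu)]
    · rw [Cn, Cn, if_neg hu, if_neg (fun h' => hu (this.2 h')), h.cp v hv.1]
  · intro v
    have := h.lt v
    unfold Cn
    split_ifs <;> omega
  · intro c' d
    by_cases hc : c' = n
    · subst hc
      have hsub : {v | (asg v ∨ Wn T asg x y z v) ∧ Cn T asg col c' x y z v = c' ∧ T.dep v = d} ⊆
          {v | T.Anc v x ∧ T.dep v = d} ∪ ({v | T.Anc v y ∧ T.dep v = d} ∪ {v | T.Anc v z ∧ T.dep v = d}) := by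
        rintro v ⟨hv | hv, hc, hd⟩
        · exfalso
          have hu : ¬ Un T asg x y z v := fun hu => hu.not_asg h.cl hv
          rw [Cn, if_neg hu] at hc
          have := h.lt v
          omega
        · rcases hv.2 with h3 | h3 | h3
          · exact Or.inl ⟨h3, hd⟩
          · exact Or.inr (Or.inl ⟨h3, hd⟩)
          · exact Or.inr (Or.inr ⟨h3, hd⟩)
      have h1 : ∀ x, {v | T.Anc v x ∧ T.dep v = d}.ncard ≤ 1 := by
        intro x
        rw [Set.ncard_le_one]
        intro v hv v' hv'
        exact T.anc_uniq hv.1 hv'.1 (hv.2.trans hv'.2.symm)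
      have := Set.ncard_le_ncard hsub
      have h3 := Set.ncard_union_le {v | T.Anc v x ∧ T.dep v = d} ({v | T.Anc v y ∧ T.dep v = d} ∪ {v | T.Anc v z ∧ T.dep v = d})
      have h4 := Set.ncard_union_le {v | T.Anc v y ∧ T.dep v = d} {v | T.Anc v z ∧ T.dep v = d}
      have := h1 x
      have := h1 y
      have := h1 z
      omega
    · refine (Set.ncard_le_ncard ?_).trans (h.cnt c' d)
      rintro v ⟨hv, hc', hd⟩
      have hu : ¬ Un T asg x y z v := fun hu => hc (by rw [← hc', Cn, if_pos hu])
      rw [Cn, if_neg hu] at hc'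
      refine ⟨hv.resolve_right ?_, hc', hd⟩
      exact fun hw => hu ⟨v, hw, T.anc_refl v⟩

theorem GR.frame {A A' : ℕ → ℕ → Prop} {asg asg' : V → Prop} {col col' : V → ℕ} {S X Y Z : List P} {a b c : ℕ}
    (h : GR T lam K asg col X a Y b Z c) (hp : Post T lam K A A' asg asg' col col' S)
    (hd : ∀ w, ¬ asg w → ∀ p ∈ S, ∀ q ∈ X ++ Y ++ Z, T.Anc w (lam p) → T.Anc w (lam q) → False) :
    GR T lam K asg' col' X a Y b Z c := by
  have key : ∀ q ∈ X ++ Y ++ Z, col' (lam q) = col (lam q) := by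
    intro q hq
    refine hp.fr _ (fun w hw hw' => ?_)
    by_contra hcon
    obtain ⟨p, hp', h1⟩ := hp.new w hw' hcon
    exact hd w hcon p hp' q hq h1 hw
  exact ⟨h.nd, h.nc, fun w hw => h.iv w (fun h' => hw (hp.mono w h')),
    fun p hp => (key p (by simp [hp])).trans (h.ca p hp),
    fun p hp => (key p (by simp [hp])).trans (h.cb p hp),
    fun p hp => (key p (by simp [hp])).trans (h.cc p hp)⟩

theorem subregion (hK : ∀ p q, K p q → K q p) {asg : V → Prop} {col : V → ℕ} {n a b : ℕ} {SA SB R : List P} {xa xb xc : P}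
    (hcl : ∀ v, asg v → asg (T.par v))
    (hnd : ((xa :: SA) ++ (SB ++ [xb]) ++ R).Nodup) (hnc : NC K ((xa :: SA) ++ (SB ++ [xb]) ++ R))
    (hiv : ∀ w, ¬ asg w → IV (fun p => T.Anc w (lam p)) ((xa :: SA) ++ (SB ++ [xb]) ++ R)) (hc : xc ∈ R)
    (ca : ∀ p ∈ xa :: SA, col (lam p) = a) (cb : ∀ p ∈ SB ++ [xb], col (lam p) = b)
    (x y z : V) (hxyz : ∀ w, Wn T asg x y z w → T.Anc w (lam xa) ∨ T.Anc w (lam xb) ∨ T.Anc w (lam xc)) :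
    ∃ MA MB M, GR T lam K (fun v => asg v ∨ Wn T asg x y z v) (Cn T asg col n x y z) MA a MB b M n ∧
      List.Perm (MA ++ MB ++ M) ((xa :: SA) ++ (SB ++ [xb])) := by
  obtain ⟨T1, M, T2, h1, h2, h3, h4⟩ := split3 (fun p => Un T asg x y z (lam p)) ((xa :: SA) ++ (SB ++ [xb])) (by
    rintro m y' z' hs ⟨hm, ⟨w, hw, hwy⟩, hz⟩
    have hmw : ¬ T.Anc w (lam m) := fun h => hm ⟨w, hw, h⟩
    have hzw : ¬ T.Anc w (lam z') := fun h => hz ⟨w, hw, h⟩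
    have hiv' := hiv w hw.1
    rcases hxyz w hw with h5 | h5 | h5
    · have hne : m ≠ xa := fun h => hmw (h ▸ h5)
      have hs' : List.Sublist [m, y', z'] (SA ++ (SB ++ [xb])) := by
        rw [List.cons_append] at hs
        cases hs with
        | cons _ h => exact h
        | cons_cons _ h => exact absurd rfl hne
      have := hiv' xa m y' z' (by
        have := (hs'.cons_cons xa).trans (List.sublist_append_left _ R)
        simpa using this)
      exact this.1 ⟨h5, hmw, hwy, hzw⟩
    · have hne : z' ≠ xb := fun h => hzw (h ▸ h5)
      have hs' : List.Sublist [m, y', z'] (xa :: SA ++ SB) := by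
        rw [← List.append_assoc, List.sublist_append_iff] at hs
        obtain ⟨l1, l2, he, hl1, hl2⟩ := hs
        rcases List.sublist_singleton.1 hl2 with rfl | rfl
        · simp at he; subst he; exact hl1
        · exfalso
          have := congrArg List.getLast? he
          simp at this
          exact hne this
      have := hiv' m y' z' xb (by
        have := ((hs'.append (List.Sublist.refl [xb])).trans (List.sublist_append_left _ R))
        simpa using this)
      exact this.2 ⟨hmw, hwy, hzw, h5⟩
    · have := hiv' m y' z' xc (by
        have := hs.append (List.singleton_sublist.2 hc)
        simpa using this)
      exact this.2 ⟨hmw, hwy, hzw, h5⟩)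
  have hM : List.Sublist M ((xa :: SA) ++ (SB ++ [xb])) := by
    rw [h1]
    exact (List.sublist_append_right T1 M).trans (List.sublist_append_left _ T2)
  rw [List.sublist_append_iff] at hM
  obtain ⟨MA, MB, hM, hMA, hMB⟩ := hM
  have hseg : List.Sublist (T1 ++ (M ++ T2)) ((xa :: SA) ++ (SB ++ [xb]) ++ R) := by
    rw [← List.append_assoc, ← h1]
    exact List.sublist_append_left _ _
  have e : MA ++ MB ++ (T2 ++ T1) = (M ++ T2) ++ T1 := by rw [hM]; simp
  refine ⟨MA, MB, T2 ++ T1, ⟨?_, ?_, ?_, ?_, ?_, ?_⟩, ?_⟩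
  · rw [e]
    exact List.nodup_append_comm.1 (hnd.sublist hseg)
  · rw [e]
    exact NC.rot hK (C4.sub hnc hseg)
  · intro w hw
    rw [e]
    exact IV.rot (C4.sub (hiv w (fun h => hw (Or.inl h))) hseg)
  · intro p hp
    have := h3 p (by rw [hM]; simp [hp])
    rw [Cn, if_neg this]
    exact ca p (hMA.subset hp)
  · intro p hp
    have := h3 p (by rw [hM]; simp [hp])
    rw [Cn, if_neg this]
    exact cb p (hMB.subset hp)
  · intro p hp
    have : Un T asg x y z (lam p) := by
      rw [List.mem_append] at hp
      rcases hp with hp | hp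
      · exact h4 p hp
      · exact h2 p hp
    rw [Cn, if_pos this]
  · rw [e, h1, List.append_assoc T1]
    exact List.perm_append_comm

end Proc



section Proc2

variable {V P : Type} {T : RT V} {lam : P → V} {K : P → P → Prop} {mm : ℕ}

theorem GR.seg (hK : ∀ p q, K p q → K q p) {asg : V → Prop} {col : V → ℕ} {X1 X2 Y1 Y2 Z : List P} {xa xb : P} {a b c : ℕ}
    (h : GR T lam K asg col (X1 ++ xa :: X2) a (Y1 ++ xb :: Y2) b Z c) :
    ((xa :: X2) ++ (Y1 ++ [xb]) ++ (Y2 ++ Z ++ X1)).Nodup ∧ NC K ((xa :: X2) ++ (Y1 ++ [xb]) ++ (Y2 ++ Z ++ X1)) ∧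
      ∀ w, ¬ asg w → IV (fun p => T.Anc w (lam p)) ((xa :: X2) ++ (Y1 ++ [xb]) ++ (Y2 ++ Z ++ X1)) := by
  have e1 : (X1 ++ xa :: X2) ++ (Y1 ++ xb :: Y2) ++ Z = X1 ++ ((xa :: X2) ++ (Y1 ++ [xb]) ++ (Y2 ++ Z)) := by simp
  have e2 : (xa :: X2) ++ (Y1 ++ [xb]) ++ (Y2 ++ Z ++ X1) = ((xa :: X2) ++ (Y1 ++ [xb]) ++ (Y2 ++ Z)) ++ X1 := by simp
  rw [e2]
  refine ⟨?_, ?_, ?_⟩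
  · have := h.nd; rw [e1] at this; exact List.nodup_append_comm.1 this
  · have := h.nc; rw [e1] at this; exact NC.rot hK this
  · intro w hw; have := h.iv w hw; rw [e1] at this; exact IV.rot this

theorem GR.sub1 (hK : ∀ p q, K p q → K q p) {asg : V → Prop} {col : V → ℕ} {X1 X2 Y1 Y2 Z : List P} {xa xb xc : P} {a b c n : ℕ}
    (hcl : ∀ v, asg v → asg (T.par v))
    (h : GR T lam K asg col (X1 ++ xa :: X2) a (Y1 ++ xb :: Y2) b Z c) (hc : xc ∈ Z)
    (x y z : V) (hxyz : ∀ w, Wn T asg x y z w → T.Anc w (lam xa) ∨ T.Anc w (lam xb) ∨ T.Anc w (lam xc)) :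
    ∃ MA MB M, GR T lam K (fun v => asg v ∨ Wn T asg x y z v) (Cn T asg col n x y z) MA a MB b M n ∧
      List.Perm (MA ++ MB ++ M) ((xa :: X2) ++ (Y1 ++ [xb])) := by
  obtain ⟨h1, h2, h3⟩ := h.seg hK
  refine subregion hK hcl h1 h2 h3 (xc := xc) (by simp [hc]) ?_ ?_ x y z hxyz
  · intro p hp; exact h.ca p (by simp at hp ⊢; tauto)
  · intro p hp; exact h.cb p (by simp at hp ⊢; tauto)

theorem GR.disj (hK : ∀ p q, K p q → K q p) {asg : V → Prop} {col : V → ℕ} {X1 X2 Y1 Y2 Z1 Z2 : List P} {xa xb xc : P} {a b c : ℕ}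
    (h : GR T lam K asg col (X1 ++ xa :: X2) a (Y1 ++ xb :: Y2) b (Z1 ++ xc :: Z2) c) {w : V} (hw : ¬ asg w)
    (ha : ¬ T.Anc w (lam xa)) (hb : ¬ T.Anc w (lam xb)) (hc : ¬ T.Anc w (lam xc)) {p q : P}
    (hp : p ∈ (xa :: X2) ++ (Y1 ++ [xb])) (hq : q ∈ (xb :: Y2) ++ (Z1 ++ [xc]))
    (hwp : T.Anc w (lam p)) (hwq : T.Anc w (lam q)) : False := by
  obtain ⟨h1, h2, h3⟩ := h.seg hK
  have hp' : p ∈ X2 ++ Y1 := by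
    simp at hp
    rcases hp with rfl | hp | hp | rfl
    · exact absurd hwp ha
    · simp [hp]
    · simp [hp]
    · exact absurd hwp hb
  have hq' : q ∈ Y2 ++ Z1 := by
    simp at hq
    rcases hq with rfl | hq | hq | rfl
    · exact absurd hwq hb
    · simp [hq]
    · simp [hq]
    · exact absurd hwq hc
  have hs : List.Sublist ([p] ++ [xb] ++ [q] ++ [xc]) ((xa :: X2) ++ (Y1 ++ [xb]) ++ (Y2 ++ (Z1 ++ xc :: Z2) ++ X1)) := by
    have := ((((List.singleton_sublist.2 hp').append (List.Sublist.refl [xb])).append (List.singleton_sublist.2 hq')).append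
      (List.Sublist.refl [xc]))
    refine this.trans ?_
    have e : (xa :: X2) ++ (Y1 ++ [xb]) ++ (Y2 ++ (Z1 ++ xc :: Z2) ++ X1) = [xa] ++ (X2 ++ Y1 ++ [xb] ++ (Y2 ++ Z1) ++ [xc]) ++ (Z2 ++ X1) := by simp
    rw [e]
    exact (List.sublist_append_right _ _).trans (List.sublist_append_left _ _)
  exact (h3 w hw p xb q xc (by simpa using hs)).1 ⟨hwp, hb, hwq, hc⟩

theorem Post.keep {A A' : ℕ → ℕ → Prop} {asg asg' : V → Prop} {col col' : V → ℕ} {S : List P}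
    (hp : Post T lam K A A' asg asg' col col' S) (hcl : ∀ v, asg v → asg (T.par v)) {v : V} (hv : asg v) :
    col' v = col v :=
  hp.fr v (fun _ hw _ => T.closed hcl hw hv)

theorem cover {K : P → P → Prop} (hK : ∀ p q, K p q → K q p) {X1 X2 Y1 Y2 Z1 Z2 : List P} {xa xb xc : P}
    (n1 : noK K (X2 ++ Y1) (Y2 ++ Z1 ++ xc :: Z2 ++ X1))
    (n2 : noK K (Y2 ++ Z1) (Z2 ++ X1 ++ xa :: X2 ++ Y1))
    (n3 : noK K (Z2 ++ X1) (X2 ++ Y1 ++ xb :: Y2 ++ Z1)) {p q : P}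
    (hp : p ∈ (X1 ++ xa :: X2) ++ (Y1 ++ xb :: Y2) ++ (Z1 ++ xc :: Z2))
    (hq : q ∈ (X1 ++ xa :: X2) ++ (Y1 ++ xb :: Y2) ++ (Z1 ++ xc :: Z2)) (hpq : K p q) :
    (p ∈ (xa :: X2) ++ (Y1 ++ [xb]) ∧ q ∈ (xa :: X2) ++ (Y1 ++ [xb])) ∨
    (p ∈ (xb :: Y2) ++ (Z1 ++ [xc]) ∧ q ∈ (xb :: Y2) ++ (Z1 ++ [xc])) ∨
    (p ∈ (xc :: Z2) ++ (X1 ++ [xa]) ∧ q ∈ (xc :: Z2) ++ (X1 ++ [xa])) := by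
  have a1 := fun h h' => n1 p h q h' hpq
  have a2 := fun h h' => n2 p h q h' hpq
  have a3 := fun h h' => n3 p h q h' hpq
  have b1 := fun h h' => n1 q h p h' (hK _ _ hpq)
  have b2 := fun h h' => n2 q h p h' (hK _ _ hpq)
  have b3 := fun h h' => n3 q h p h' (hK _ _ hpq)
  clear n1 n2 n3 hpq hK
  simp only [List.mem_append, List.mem_cons, List.not_mem_nil, or_false] at *
  generalize (p ∈ X1) = p1 at *
  generalize (p ∈ X2) = p2 at *
  generalize (p ∈ Y1) = p3 at *
  generalize (p ∈ Y2) = p4 at *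
  generalize (p ∈ Z1) = p5 at *
  generalize (p ∈ Z2) = p6 at *
  generalize (p = xa) = p7 at *
  generalize (p = xb) = p8 at *
  generalize (p = xc) = p9 at *
  generalize (q ∈ X1) = q1 at *
  generalize (q ∈ X2) = q2 at *
  generalize (q ∈ Y1) = q3 at *
  generalize (q ∈ Y2) = q4 at *
  generalize (q ∈ Z1) = q5 at *
  generalize (q ∈ Z2) = q6 at *
  generalize (q = xa) = q7 at *
  generalize (q = xb) = q8 at *
  generalize (q = xc) = q9 at *
  rcases hp with ((hp | hp | hp) | (hp | hp | hp)) | (hp | hp | hp) <;> simp only [hp, true_or, or_true, true_and, forall_const, imp_false] at * <;> grind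

/-- The induction hypothesis. -/
def ProcLT (T : RT V) (lam : P → V) (K : P → P → Prop) (mm k : ℕ) : Prop :=
  ∀ n A asg col a b c ts X Y Z, (X ++ Y ++ Z).length < k →
    (3 ≤ (X ++ Y ++ Z).length ∨ ∀ p ∈ X ++ Y ++ Z, asg (lam p)) →
    St T mm n A asg col ((a, b, c) :: ts) → GR T lam K asg col X a Y b Z c →
    Done T lam K mm A asg col ts (X ++ Y ++ Z)

theorem proc_main [Finite V] (hmm : 3 ≤ mm) (hK : ∀ p q, K p q → K q p) {n : ℕ} {A : ℕ → ℕ → Prop} {asg : V → Prop}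
    {col : V → ℕ} {a b c : ℕ} {ts : List (ℕ × ℕ × ℕ)} {X Y Z : List P}
    (ih : ProcLT T lam K mm (X ++ Y ++ Z).length)
    (hs : St T mm n A asg col ((a, b, c) :: ts)) (hg : GR T lam K asg col X a Y b Z c)
    (hX : X ≠ []) (hY : Y ≠ []) (hZ : Z ≠ []) : Done T lam K mm A asg col ts (X ++ Y ++ Z) := by
  obtain ⟨X0, xl, rfl⟩ := (List.eq_nil_or_concat X).resolve_left hX
  obtain ⟨yh, Y0, rfl⟩ := List.exists_cons_of_ne_nil hY
  obtain ⟨X1, xa, X2, Y1, xb, Y2, Z1, xc, Z2, e1, e2, e3, n1, n2, n3⟩ :=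
    lemF K hK (X0.length + Y0.length + 1) X0 xl [] [] yh Y0 Z (by omega) hZ (by simpa using hg.nc) (by simp [noK])
  have e1' : X0.concat xl = X1 ++ xa :: X2 := by rw [e1]; simp
  have e2' : yh :: Y0 = Y1 ++ xb :: Y2 := by rw [e2]; simp
  rw [e1', e2', ← e3] at hg ih ⊢
  clear e1 e2 e3 e1' e2' hX hY hZ
  obtain ⟨A0, hA0, hs0⟩ := hs.stack hmm (lam xa) (lam xb) (lam xc)
  have xasg : ∀ x, x = xa ∨ x = xb ∨ x = xc → asg (lam x) ∨ Wn T asg (lam xa) (lam xb) (lam xc) (lam x) := by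
    intro x hx
    by_cases h : asg (lam x)
    · exact Or.inl h
    · refine Or.inr ⟨h, ?_⟩
      rcases hx with rfl | rfl | rfl
      · exact Or.inl (T.anc_refl _)
      · exact Or.inr (Or.inl (T.anc_refl _))
      · exact Or.inr (Or.inr (T.anc_refl _))
  have hgr := hg.rot hK
  have hgrr := hgr.rot hK
  obtain ⟨MA1, MB1, M1, g1, p1⟩ := hg.sub1 (n := n) (xc := xc) hK hs.cl (by simp) (lam xa) (lam xb) (lam xc) (fun w hw => hw.2)
  obtain ⟨MA2, MB2, M2, g2, p2⟩ := hgr.sub1 (n := n) (xc := xa) hK hs.cl (by simp) (lam xa) (lam xb) (lam xc)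
    (fun w hw => by have := hw.2; tauto)
  obtain ⟨MA3, MB3, M3, g3, p3⟩ := hgrr.sub1 (n := n) (xc := xb) hK hs.cl (by simp) (lam xa) (lam xb) (lam xc)
    (fun w hw => by have := hw.2; tauto)
  generalize hasg0 : (fun v => asg v ∨ Wn T asg (lam xa) (lam xb) (lam xc) v) = asg0 at *
  have hasg0' : ∀ v, asg0 v ↔ asg v ∨ Wn T asg (lam xa) (lam xb) (lam xc) v := by
    intro v; rw [← hasg0]
  have m0 : ∀ v, asg v → asg0 v := fun v hv => (hasg0' v).2 (Or.inl hv)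
  have xasg0 : ∀ x, x = xa ∨ x = xb ∨ x = xc → asg0 (lam x) := fun x hx => (hasg0' _).2 (xasg x hx)
  have nanc : ∀ w, ¬ asg0 w → ∀ x, x = xa ∨ x = xb ∨ x = xc → ¬ T.Anc w (lam x) := by
    intro w hw x hx h
    exact hw (T.closed hs0.cl h (xasg0 x hx))
  have d12 : ∀ w, ¬ asg0 w → ∀ p ∈ MA1 ++ MB1 ++ M1, ∀ q ∈ MA2 ++ MB2 ++ M2, T.Anc w (lam p) → T.Anc w (lam q) → False := by
    intro w hw p hp q hq
    exact hg.disj hK (fun h => hw (m0 w h)) (nanc w hw _ (by tauto)) (nanc w hw _ (by tauto)) (nanc w hw _ (by tauto))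
      (p1.mem_iff.1 hp) (p2.mem_iff.1 hq)
  have d23 : ∀ w, ¬ asg0 w → ∀ p ∈ MA2 ++ MB2 ++ M2, ∀ q ∈ MA3 ++ MB3 ++ M3, T.Anc w (lam p) → T.Anc w (lam q) → False := by
    intro w hw p hp q hq
    exact hgr.disj hK (fun h => hw (m0 w h)) (nanc w hw _ (by tauto)) (nanc w hw _ (by tauto)) (nanc w hw _ (by tauto))
      (p2.mem_iff.1 hp) (p3.mem_iff.1 hq)
  have d13 : ∀ w, ¬ asg0 w → ∀ p ∈ MA1 ++ MB1 ++ M1, ∀ q ∈ MA3 ++ MB3 ++ M3, T.Anc w (lam p) → T.Anc w (lam q) → False := by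
    intro w hw p hp q hq h1 h2
    exact hgrr.disj hK (fun h => hw (m0 w h)) (nanc w hw _ (by tauto)) (nanc w hw _ (by tauto)) (nanc w hw _ (by tauto))
      (p3.mem_iff.1 hq) (p1.mem_iff.1 hp) h2 h1
  have len : ∀ {M I J : List P} {x y : P}, List.Perm M ((x :: I) ++ (J ++ [y])) → (x = xa ∨ x = xb ∨ x = xc) →
      (y = xa ∨ y = xb ∨ y = xc) → ∀ asg' : V → Prop, (∀ v, asg0 v → asg' v) → (3 ≤ M.length ∨ ∀ p ∈ M, asg' (lam p)) := by
    intro M I J x y hM hx hy asg' hm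
    by_cases h3 : 3 ≤ M.length
    · exact Or.inl h3
    · right
      have h4 := hM.length_eq
      simp at h4
      have hI : I = [] := List.length_eq_zero_iff.1 (by omega)
      have hJ : J = [] := List.length_eq_zero_iff.1 (by omega)
      subst hI hJ
      intro p hp
      have := hM.mem_iff.1 hp
      simp at this
      rcases this with rfl | rfl
      · exact hm _ (xasg0 _ hx)
      · exact hm _ (xasg0 _ hy)
  obtain ⟨k1, A1, asg1, col1, s1, P1⟩ := ih _ _ _ _ _ _ _ _ _ _ _ (by rw [p1.length_eq]; simp; omega)
    (len p1 (by tauto) (by tauto) asg0 (fun _ h => h)) hs0 g1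
  obtain ⟨k2, A2, asg2, col2, s2, P2⟩ := ih _ _ _ _ _ _ _ _ _ _ _ (by rw [p2.length_eq]; simp; omega)
    (len p2 (by tauto) (by tauto) asg1 P1.mono) s1 (g2.frame P1 d12)
  obtain ⟨k3, A3, asg3, col3, s3, P3⟩ := ih _ _ _ _ _ _ _ _ _ _ _ (by rw [p3.length_eq]; simp; omega)
    (len p3 (by tauto) (by tauto) asg2 (fun v h => P2.mono v (P1.mono v h))) s2
      ((g3.frame P1 d13).frame P2 (fun w hw => d23 w (fun h => hw (P1.mono w h))))
  refine ⟨k3, A3, asg3, col3, s3, ?_, ?_, ?_, ?_, ?_, ?_⟩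
  · exact fun i j h => P3.mA _ _ (P2.mA _ _ (P1.mA _ _ (hA0 i j h)))
  · exact fun v h => P3.mono _ (P2.mono _ (P1.mono _ (m0 v h)))
  · intro v hv
    have hu : ¬ Un T asg (lam xa) (lam xb) (lam xc) v := by
      rintro ⟨w, hw, hwv⟩
      exact hw.1 (hv w hwv (P3.mono _ (P2.mono _ (P1.mono _ ((hasg0' w).2 (Or.inr hw))))))
    rw [P3.fr v (fun w hw h => P2.mono _ (P1.mono _ (m0 _ (hv w hw h)))),
      P2.fr v (fun w hw h => P1.mono _ (m0 _ (hv w hw (P3.mono _ h)))),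
      P1.fr v (fun w hw h => m0 _ (hv w hw (P3.mono _ (P2.mono _ h)))), Cn, if_neg hu]
  · intro w hw hw'
    by_cases h2 : asg2 w
    · by_cases h1 : asg1 w
      · by_cases h0 : asg0 w
        · rcases (hasg0' w).1 h0 with h | h
          · exact absurd h hw'
          · rcases h.2 with h | h | h
            · exact ⟨xa, by simp, h⟩
            · exact ⟨xb, by simp, h⟩
            · exact ⟨xc, by simp, h⟩
        · obtain ⟨p, hp, h⟩ := P1.new w h1 h0
          refine ⟨p, ?_, h⟩
          have := p1.mem_iff.1 hp
          simp at this ⊢; tauto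
      · obtain ⟨p, hp, h⟩ := P2.new w h2 h1
        refine ⟨p, ?_, h⟩
        have := p2.mem_iff.1 hp
        simp at this ⊢; tauto
    · obtain ⟨p, hp, h⟩ := P3.new w hw h2
      refine ⟨p, ?_, h⟩
      have := p3.mem_iff.1 hp
      simp at this ⊢; tauto
  · intro p hp
    have : p ∈ (xa :: X2) ++ (Y1 ++ [xb]) ∨ p ∈ (xb :: Y2) ++ (Z1 ++ [xc]) ∨ p ∈ (xc :: Z2) ++ (X1 ++ [xa]) := by
      simp at hp ⊢; tauto
    rcases this with h | h | h
    · exact P3.mono _ (P2.mono _ (P1.all p (p1.mem_iff.2 h)))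
    · exact P3.mono _ (P2.all p (p2.mem_iff.2 h))
    · exact P3.all p (p3.mem_iff.2 h)
  · intro p hp q hq hpq
    rcases cover hK n1 n2 n3 hp hq hpq with ⟨h, h'⟩ | ⟨h, h'⟩ | ⟨h, h'⟩
    · have k := P1.ed p (p1.mem_iff.2 h) q (p1.mem_iff.2 h') hpq
      have b1 := P1.all p (p1.mem_iff.2 h)
      have b2 := P1.all q (p1.mem_iff.2 h')
      rw [P3.keep s2.cl (P2.mono _ b1), P3.keep s2.cl (P2.mono _ b2), P2.keep s1.cl b1, P2.keep s1.cl b2]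
      exact k.imp id (fun h => P3.mA _ _ (P2.mA _ _ h))
    · have k := P2.ed p (p2.mem_iff.2 h) q (p2.mem_iff.2 h') hpq
      have b1 := P2.all p (p2.mem_iff.2 h)
      have b2 := P2.all q (p2.mem_iff.2 h')
      rw [P3.keep s2.cl b1, P3.keep s2.cl b2]
      exact k.imp id (fun h => P3.mA _ _ h)
    · exact P3.ed p (p3.mem_iff.2 h) q (p3.mem_iff.2 h') hpq

end Proc2



section Proc3

variable {V P : Type} {T : RT V} {lam : P → V} {K : P → P → Prop} {mm : ℕ}

/-- The region with the given arcs can be processed. -/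
def QP (T : RT V) (lam : P → V) (K : P → P → Prop) (mm : ℕ) (X Y Z : List P) : Prop :=
  ∀ n A asg col a b c ts, St T mm n A asg col ((a, b, c) :: ts) → GR T lam K asg col X a Y b Z c →
    Done T lam K mm A asg col ts (X ++ Y ++ Z)

theorem QP.rot (hK : ∀ p q, K p q → K q p) {X Y Z : List P} (h : QP T lam K mm Y Z X) : QP T lam K mm X Y Z := by
  intro n A asg col a b c ts hs hg
  exact (h _ _ _ _ _ _ _ _ hs.rot (hg.rot hK)).mono (fun _ _ h => h) (fun p => by simp; tauto)

theorem QP.e1 (hK : ∀ p q, K p q → K q p) {x : P} {X Y : List P} (h : QP T lam K mm X Y [x]) :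
    QP T lam K mm (x :: X) Y [] := by
  intro n A asg col a b c ts hs hg
  obtain ⟨A', hA, hs'⟩ := hs.dup
  refine (h _ _ _ _ _ _ _ _ hs' ?_).mono hA (fun p => by simp; tauto)
  have e : (x :: X) ++ Y ++ [] = [x] ++ (X ++ Y) := by simp
  refine ⟨?_, ?_, ?_, ?_, hg.cb, ?_⟩
  · have := hg.nd; rw [e] at this; exact List.nodup_append_comm.1 this
  · have := hg.nc; rw [e] at this; exact NC.rot hK this
  · intro w hw; have := hg.iv w hw; rw [e] at this; exact IV.rot this
  · intro p hp; exact hg.ca p (by simp [hp])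
  · intro p hp; exact hg.ca p (by simp at hp; simp [hp])

theorem QP.e2 (hK : ∀ p q, K p q → K q p) {X Y1 Y2 : List P} (h : QP T lam K mm Y2 X Y1) :
    QP T lam K mm X (Y1 ++ Y2) [] := by
  intro n A asg col a b c ts hs hg
  obtain ⟨A', hA, hs'⟩ := hs.dup
  obtain ⟨A'', hA', hs''⟩ := hs'.rot.dup
  refine (h _ _ _ _ _ _ _ _ hs'' ?_).mono (fun i j h => hA' _ _ (hA _ _ h)) (fun p => by simp; tauto)
  have e : X ++ (Y1 ++ Y2) ++ [] = (X ++ Y1) ++ Y2 := by simp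
  have e' : Y2 ++ X ++ Y1 = Y2 ++ (X ++ Y1) := by simp
  refine ⟨?_, ?_, ?_, ?_, hg.ca, ?_⟩
  · have := hg.nd; rw [e] at this; rw [e']; exact List.nodup_append_comm.1 this
  · have := hg.nc; rw [e] at this; rw [e']; exact NC.rot hK this
  · intro w hw; have := hg.iv w hw; rw [e] at this; rw [e']; exact IV.rot this
  · intro p hp; exact hg.cb p (by simp [hp])
  · intro p hp; exact hg.cb p (by simp [hp])

theorem proc [Finite V] (hmm : 3 ≤ mm) (hK : ∀ p q, K p q → K q p) : ∀ k, ProcLT T lam K mm k := by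
  intro k
  induction k with
  | zero => intro n A asg col a b c ts X Y Z h; omega
  | succ k ih =>
    have main : ∀ X Y Z : List P, (X ++ Y ++ Z).length = k → X ≠ [] → Y ≠ [] → Z ≠ [] → QP T lam K mm X Y Z := by
      intro X Y Z hl hX hY hZ n A asg col a b c ts hs hg
      exact proc_main hmm hK (by rw [hl]; exact ih) hs hg hX hY hZ
    have two : ∀ X Y : List P, (X ++ Y).length = k → 3 ≤ k → X ≠ [] → Y ≠ [] → QP T lam K mm X Y [] := by
      intro X Y hl h3 hX hY
      obtain ⟨x, X', rfl⟩ := List.exists_cons_of_ne_nil hX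
      by_cases hX' : X' = []
      · subst hX'
        obtain ⟨y, Y', rfl⟩ := List.exists_cons_of_ne_nil hY
        refine QP.e2 (Y1 := [y]) hK (main _ _ _ ?_ ?_ (by simp) (by simp))
        · simp at hl ⊢; omega
        · rintro rfl; simp at hl; omega
      · refine QP.e1 hK (main _ _ _ ?_ hX' hY (by simp))
        simp at hl ⊢; omega
    have one : ∀ X : List P, X.length = k → 3 ≤ k → QP T lam K mm X [] [] := by
      intro X hl h3
      obtain ⟨x, X', rfl⟩ := List.exists_cons_of_ne_nil (l := X) (by rintro rfl; simp at hl; omega)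
      refine QP.e1 hK (QP.rot hK (QP.rot hK (two _ _ ?_ h3 (by simp) ?_)))
      · simp at hl ⊢; omega
      · rintro rfl; simp at hl; omega
    intro n A asg col a b c ts X Y Z hlt hall hs hg
    by_cases hall' : ∀ p ∈ X ++ Y ++ Z, asg (lam p)
    · exact done_of_asg hs hg hall'
    have h3 := hall.resolve_right hall'
    rcases Nat.lt_succ_iff_lt_or_eq.1 hlt with hlt | hl
    · exact ih _ _ _ _ _ _ _ _ _ _ _ hlt hall hs hg
    rw [hl] at h3
    revert hs hg
    suffices QP T lam K mm X Y Z from this _ _ _ _ _ _ _ _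
    simp only [List.length_append] at hl
    rcases eq_or_ne X [] with rfl | hX <;> rcases eq_or_ne Y [] with rfl | hY <;> rcases eq_or_ne Z [] with rfl | hZ
    · simp at hl; omega
    · exact QP.rot hK (QP.rot hK (one _ (by simpa using hl) h3))
    · exact QP.rot hK (one _ (by simpa using hl) h3)
    · exact QP.rot hK (two _ _ (by simpa using hl) h3 hY hZ)
    · exact one _ (by simpa using hl) h3
    · exact QP.rot hK (QP.rot hK (two _ _ (by simp at hl ⊢; omega) h3 hZ hX))
    · exact two _ _ (by simpa using hl) h3 hX hY
    · exact main _ _ _ (by simp; omega) hX hY hZ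

theorem partB [Finite V] (T : RT V) (lam : P → V) (K : P → P → Prop) (mm : ℕ) (hmm : 3 ≤ mm) (hK : ∀ p q, K p q → K q p)
    (L : List P) (hnd : L.Nodup) (hl : 3 ≤ L.length) (hnc : NC K L) (Z : V → Prop) (hr : Z T.r)
    (hcl : ∀ v, Z v → Z (T.par v)) (hcnt : ∀ d, {v | Z v ∧ T.dep v = d}.ncard ≤ mm)
    (hiv : ∀ w, ¬ Z w → IV (fun p => T.Anc w (lam p)) L) (hcov : ∀ v, v ≠ T.r → ∃ p ∈ L, lam p = v) :
    ∃ (n : ℕ) (A : ℕ → ℕ → Prop) (col : V → ℕ), HS n A [] ∧ (∀ v : V, col v < n) ∧ (∀ c d, {v | col v = c ∧ T.dep v = d}.ncard ≤ mm) ∧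
      ∀ p ∈ L, ∀ q ∈ L, K p q → col (lam p) = col (lam q) ∨ A (col (lam p)) (col (lam q)) := by
  obtain ⟨A, hA⟩ := HS.base
  have hs : St T mm 1 A Z (fun _ => 0) [(0, 0, 0)] := by
    refine ⟨hA, hr, hcl, fun _ _ => rfl, fun _ => by simp, fun c d => le_trans (Set.ncard_le_ncard ?_ (Set.toFinite _)) (hcnt d)⟩
    rintro v ⟨h1, _, h2⟩
    exact ⟨h1, h2⟩
  have hg : GR T lam K Z (fun _ => 0) L 0 [] 0 [] 0 := by
    refine ⟨by simpa using hnd, by simpa using hnc, fun w hw => by simpa using hiv w hw, fun _ _ => rfl, fun _ _ => rfl, fun _ _ => rfl⟩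
  obtain ⟨n, A', asg, col, s, Q⟩ := proc hmm hK _ _ _ _ _ _ _ _ _ _ _ _ (Nat.lt_succ_self _) (Or.inl (by simpa using hl)) hs hg
  refine ⟨n, A', col, s.hs, s.lt, fun c d => le_trans (Set.ncard_le_ncard ?_ (Set.toFinite _)) (s.cnt c d), ?_⟩
  · rintro v ⟨h1, h2⟩
    refine ⟨?_, h1, h2⟩
    by_cases hv : v = T.r
    · subst hv; exact s.rt
    · obtain ⟨p, hp, rfl⟩ := hcov v hv
      exact Q.all p (by simpa using hp)
  · intro p hp q hq
    exact Q.ed p (by simpa using hp) q (by simpa using hq)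

end Proc3



/-! ### Dual connectivity -/

namespace Multigraph

variable {V E F : Type} {M : Multigraph V E}

open Classical in
/-- The number of occurrences of an edge in a closed walk. -/
noncomputable def CWalk.cnt (W : M.CWalk) (e : E) : ℕ := ((Finset.range W.len).filter (fun i => W.edge i = e)).card

theorem CWalk.cnt_pos (W : M.CWalk) (e : E) : 0 < W.cnt e ↔ ∃ i < W.len, W.edge i = e := by
  classical
  unfold CWalk.cnt
  rw [Finset.card_pos]
  constructor
  · rintro ⟨i, hi⟩
    simp at hi
    exact ⟨i, hi⟩
  · rintro ⟨i, hi⟩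
    exact ⟨i, by simpa using hi⟩

theorem Embedding.sum_cnt [Fintype F] (emb : M.Embedding F) (e : E) : ∑ f, (emb.boundary f).cnt e = 2 := by
  classical
  rw [← emb.edge_twice e]
  have : {p : F × ℕ | IsOcc emb.boundary e p} =
      ((Finset.univ.sigma (fun f => (Finset.range (emb.boundary f).len).filter (fun i => (emb.boundary f).edge i = e))).map
        (Equiv.sigmaEquivProd F ℕ).toEmbedding : Finset (F × ℕ)) := by
    ext ⟨f, i⟩
    simp [IsOcc, Equiv.sigmaEquivProd]
  rw [this, Set.ncard_coe_finset, Finset.card_map, Finset.card_sigma]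
  rfl

theorem Embedding.exists_occ (emb : M.Embedding F) (e : E) : ∃ p, IsOcc emb.boundary e p := by
  have h := emb.edge_twice e
  have h2 : {p : F × ℕ | IsOcc emb.boundary e p}.Nonempty := by
    rw [← Set.ncard_pos (Set.finite_of_ncard_ne_zero (by omega))]
    omega
  exact h2

/-- A predicate on faces is constant across an edge. -/
def Cst (emb : M.Embedding F) (s : F → Prop) (e : E) : Prop :=
  ∀ p p', IsOcc emb.boundary e p → IsOcc emb.boundary e p' → (s p.1 → s p'.1)

open Classical in
theorem Cst.even [Fintype F] {emb : M.Embedding F} {s : F → Prop} {e : E} (h : Cst emb s e) :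
    (∑ f ∈ Finset.univ.filter s, (emb.boundary f).cnt e) = 0 ∨ (∑ f ∈ Finset.univ.filter s, (emb.boundary f).cnt e) = 2 := by
  obtain ⟨p, hp⟩ := emb.exists_occ e
  by_cases hs : s p.1
  · right
    rw [← emb.sum_cnt e]
    refine Finset.sum_subset (Finset.subset_univ _) ?_
    intro f _ hf
    by_contra h0
    obtain ⟨i, hi⟩ := (CWalk.cnt_pos _ _).1 (Nat.pos_of_ne_zero h0)
    exact hf (by simpa using h p (f, i) hp hi hs)
  · left
    refine Finset.sum_eq_zero ?_
    intro f hf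
    by_contra h0
    obtain ⟨i, hi⟩ := (CWalk.cnt_pos _ _).1 (Nat.pos_of_ne_zero h0)
    exact hs (h (f, i) p hi hp (by simpa using hf))

open Classical in
theorem Cst.of_even [Fintype F] {emb : M.Embedding F} {s : F → Prop} {e : E}
    (h : Even (∑ f ∈ Finset.univ.filter s, (emb.boundary f).cnt e)) : Cst emb s e := by
  intro p p' hp hp' hs
  by_contra hs'
  have h2 : ∑ f ∈ Finset.univ.filter s, (emb.boundary f).cnt e +
      ∑ f ∈ Finset.univ.filter (fun f => ¬ s f), (emb.boundary f).cnt e = 2 := by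
    rw [← emb.sum_cnt e]
    convert Finset.sum_filter_add_sum_filter_not Finset.univ s _
  have h3 : 0 < ∑ f ∈ Finset.univ.filter s, (emb.boundary f).cnt e :=
    lt_of_lt_of_le ((CWalk.cnt_pos _ _).2 ⟨p.2, hp⟩)
      (Finset.single_le_sum (f := fun f => (emb.boundary f).cnt e) (fun _ _ => Nat.zero_le _) (by simpa using hs))
  have h4 : 0 < ∑ f ∈ Finset.univ.filter (fun f => ¬ s f), (emb.boundary f).cnt e :=
    lt_of_lt_of_le ((CWalk.cnt_pos _ _).2 ⟨p'.2, hp'⟩)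
      (Finset.single_le_sum (f := fun f => (emb.boundary f).cnt e) (fun _ _ => Nat.zero_le _) (by simpa using hs'))
  obtain ⟨k, hk⟩ := h
  omega

open Classical in
/-- Incidence of a vertex with a pair, modulo two. -/
noncomputable def inc (c : V) : Sym2 V → ZMod 2 :=
  Sym2.lift ⟨fun a b => (if a = c then 1 else 0) + (if b = c then 1 else 0), fun _ _ => add_comm _ _⟩

theorem CWalk.inc_sum (W : M.CWalk) (c : V) : ∑ i ∈ Finset.range W.len, inc c (M.ends (W.edge i)) = 0 := by
  classical
  have h1 : ∀ i ∈ Finset.range W.len, inc c (M.ends (W.edge i)) =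
      (if W.vtx i = c then 1 else 0) + (if W.vtx (i + 1) = c then 1 else 0) := by
    intro i _
    rw [W.compat i]; rfl
  rw [Finset.sum_congr rfl h1, Finset.sum_add_distrib]
  have h2 := Finset.sum_range_succ (fun i => if W.vtx i = c then (1 : ZMod 2) else 0) W.len
  have h3 := Finset.sum_range_succ' (fun i => if W.vtx i = c then (1 : ZMod 2) else 0) W.len
  have h4 : W.vtx W.len = W.vtx 0 := by simpa using W.vtx_per 0
  rw [h2, h4] at h3
  rw [← add_right_cancel h3]
  exact CharTwo.add_self_eq_zero _

open Classical in
theorem inc_edges [Fintype F] [Fintype E] (emb : M.Embedding F) (s : F → Prop) (c : V) :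
    ∑ e, ((∑ f ∈ Finset.univ.filter s, (emb.boundary f).cnt e : ℕ) : ZMod 2) * inc c (M.ends e) = 0 := by
  have h : ∀ f, ∑ e, ((emb.boundary f).cnt e : ZMod 2) * inc c (M.ends e) = 0 := by
    intro f
    rw [← (emb.boundary f).inc_sum c, ← Finset.sum_fiberwise' _ (emb.boundary f).edge (fun e => inc c (M.ends e))]
    refine Finset.sum_congr rfl ?_
    intro e _
    rw [Finset.sum_const, nsmul_eq_mul]; rfl
  simp_rw [Nat.cast_sum, Finset.sum_mul]
  rw [Finset.sum_comm]
  exact Finset.sum_eq_zero (fun f _ => h f)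

/-- `te` gives the tree edges of the rooted tree `T`. -/
def TE (M : Multigraph V E) (T : RT V) (te : V → E) : Prop := ∀ v, v ≠ T.r → M.ends (te v) = s(v, T.par v)

theorem TE.inj {T : RT V} {te : V → E} (h : TE M T te) {v w : V} (hv : v ≠ T.r) (hw : w ≠ T.r) (he : te v = te w) : v = w := by
  have h1 := h v hv
  rw [he, h w hw] at h1
  rcases Sym2.eq_iff.1 h1 with h2 | h2
  · exact h2.1.symm
  · have h3 := T.dep_par v hv
    have h4 := T.dep_par w hw
    rw [← h2.1] at h3
    rw [h2.2] at h4
    omega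

theorem dual_conn [Finite V] [Finite E] [Finite F] (emb : M.Embedding F) {T : RT V} {te : V → E} (hT : TE M T te)
    (s : F → Prop) (hs : ∀ e, (∀ v, v ≠ T.r → te v ≠ e) → Cst emb s e) (f f' : F) (hf : s f) : s f' := by
  classical
  have := Fintype.ofFinite V
  have := Fintype.ofFinite E
  have := Fintype.ofFinite F
  obtain ⟨D, hD⟩ : ∃ D, ∀ v, T.dep v ≤ D :=
    ⟨Finset.univ.sup T.dep, fun v => Finset.le_sup (f := T.dep) (Finset.mem_univ v)⟩
  have step : ∀ k, ∀ c, c ≠ T.r → D < T.dep c + k → Cst emb s (te c) := by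
    intro k
    induction k with
    | zero => intro c _ h; have := hD c; omega
    | succ k ih =>
      intro c hc hk
      apply Cst.of_even
      have h1 := inc_edges emb s c
      rw [Finset.sum_eq_single (te c)] at h1
      · rw [hT c hc] at h1
        have hp : T.par c ≠ c := by
          intro h
          have := T.dep_par c hc
          rw [h] at this; omega
        have h2 : inc c s(c, T.par c) = 1 := by simp [inc, hp]
        rw [h2, mul_one, ZMod.natCast_eq_zero_iff] at h1
        exact even_iff_two_dvd.2 h1
      · intro e _ he
        have ev : Cst emb s e → ((∑ f ∈ Finset.univ.filter s, (emb.boundary f).cnt e : ℕ) : ZMod 2) * inc c (M.ends e) = 0 := by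
          intro h
          rcases h.even with h | h <;> rw [h]
          · simp
          · have : ((2 : ℕ) : ZMod 2) = 0 := rfl
            rw [this, zero_mul]
        by_cases hte : ∃ v, v ≠ T.r ∧ te v = e
        · obtain ⟨v, hv, rfl⟩ := hte
          by_cases hvc : v = c
          · subst hvc; exact absurd rfl he
          · by_cases hpc : T.par v = c
            · apply ev
              apply ih v hv
              have := T.dep_par v hv
              rw [hpc] at this; omega
            · rw [hT v hv]
              simp [inc, hvc, hpc]
        · push Not at hte
          exact ev (hs e hte)
      · simp
  have all : ∀ e, Cst emb s e := by
    intro e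
    by_cases hte : ∃ v, v ≠ T.r ∧ te v = e
    · obtain ⟨v, hv, rfl⟩ := hte
      exact step (D + 1) v hv (by omega)
    · push Not at hte
      exact hs e hte
  have lk : ∀ v c c', Relation.EqvGen (CornerLinked emb.boundary v) c c' → (s c.1 ↔ s c'.1) := by
    intro v c c' h
    induction h with
    | rel x y h =>
      obtain ⟨_, _, e, p, p', _, hp, hp', h1, h2⟩ := h
      rw [h1.1, h2.1]
      exact ⟨all e p p' hp hp', all e p' p hp' hp⟩
    | refl => exact Iff.rfl
    | symm _ _ _ ih => exact ih.symm
    | trans _ _ _ _ _ ih1 ih2 => exact ih1.trans ih2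
  have cor : ∀ v c c', IsCorner emb.boundary v c → IsCorner emb.boundary v c' → (s c.1 ↔ s c'.1) :=
    fun v c c' h h' => lk v c c' (emb.link_conn v c c' h h')
  have corner0 : ∀ f, IsCorner emb.boundary ((emb.boundary f).vtx 0) (f, 0) := fun f => ⟨(emb.boundary f).len_pos, rfl⟩
  have key : ∀ u v, Relation.ReflTransGen M.simple.Adj u v → ∀ c c', IsCorner emb.boundary u c → IsCorner emb.boundary v c' →
      (s c.1 ↔ s c'.1) := by
    intro u v h
    induction h with
    | refl => exact cor u
    | tail _ h ih =>
      rename_i x y _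
      intro c c' hc hc'
      obtain ⟨_, e, he⟩ := h
      obtain ⟨p, hp⟩ := emb.exists_occ e
      have h1 := (emb.boundary p.1).compat p.2
      rw [hp.2, he] at h1
      have hA : IsCorner emb.boundary ((emb.boundary p.1).vtx p.2) p := ⟨hp.1, rfl⟩
      have hB : IsCorner emb.boundary ((emb.boundary p.1).vtx (p.2 + 1)) (p.1, (p.2 + 1) % (emb.boundary p.1).len) :=
        ⟨Nat.mod_lt _ (emb.boundary p.1).len_pos, CWalk.vtx_mod _ _⟩
      rcases Sym2.eq_iff.1 h1 with ⟨h2, h3⟩ | ⟨h2, h3⟩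
      · rw [← h2] at hA
        rw [← h3] at hB
        have t := cor y _ c' hB hc'
        exact (ih c p hc hA).trans t
      · rw [← h3] at hA
        rw [← h2] at hB
        exact (ih c (p.1, _) hc hB).trans (cor y p c' hA hc')
  have hc := emb.conn.preconnected ((emb.boundary f).vtx 0) ((emb.boundary f').vtx 0)
  rw [SimpleGraph.reachable_iff_reflTransGen] at hc
  exact (key _ _ hc _ _ (corner0 f) (corner0 f')).1 hf

/-- Breadth-first spanning trees exist. -/
theorem exists_tree (M : Multigraph V E) (hM : M.simple.Connected) (hE0 : Nonempty E) : ∃ (T : RT V) (te : V → E), TE M T te ∧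
    ∀ u v, M.simple.Adj u v → T.dep u ≤ T.dep v + 1 := by
  classical
  obtain ⟨r⟩ := hM.nonempty
  have h : ∀ v, ∃ u, v ≠ r → M.simple.Adj v u ∧ M.simple.dist r u + 1 = M.simple.dist r v := by
    intro v
    by_cases hv : v = r
    · exact ⟨r, fun h => absurd hv h⟩
    obtain ⟨p, hp⟩ := hM.exists_walk_length_eq_dist v r
    cases p with
    | nil => exact absurd rfl hv
    | cons h q =>
      rename_i u
      refine ⟨u, fun _ => ⟨h, ?_⟩⟩
      rw [SimpleGraph.Walk.length_cons] at hp
      have h1 := SimpleGraph.dist_le q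
      have h2 := h.diff_dist_adj (u := r)
      rw [SimpleGraph.dist_comm (u := r) (v := u), SimpleGraph.dist_comm (u := r) (v := v)] at *
      omega
  choose par hpar using h
  have hE : ∀ v, v ≠ r → ∃ e, M.ends e = s(v, par v) := fun v hv => (hpar v hv).1.2
  obtain ⟨e0⟩ := hE0
  have : ∀ v, ∃ e, v ≠ r → M.ends e = s(v, par v) := by
    intro v
    by_cases hv : v = r
    · exact ⟨e0, fun h => absurd hv h⟩
    · obtain ⟨e, he⟩ := hE v hv
      exact ⟨e, fun _ => he⟩
  choose te hte using this
  refine ⟨⟨r, fun v => if v = r then r else par v, fun v => M.simple.dist r v, by simp, ?_⟩, te, ?_, ?_⟩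
  · intro v hv
    rw [if_neg hv]
    exact (hpar v hv).2
  · intro v hv
    change M.ends (te v) = s(v, if v = r then r else par v)
    rw [if_neg hv]
    exact hte v hv
  · intro u v huv
    have := huv.diff_dist_adj (u := r)
    change M.simple.dist r u ≤ M.simple.dist r v + 1
    omega

end Multigraph



/-! ### Polygons -/

section Polygon

theorem consec_aux1 {P : Type} {a b c : P} (B : List P) : ∀ A : List P, (A ++ a :: c :: B).Nodup →
    List.Sublist [a, b, c] (A ++ a :: c :: B) → False := by
  intro A
  induction A with
  | nil =>
    intro hn hs
    simp only [List.nil_append, List.nodup_cons, List.mem_cons, not_or] at hn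
    have h1 : List.Sublist [b, c] (c :: B) := by
      rw [List.nil_append] at hs
      exact List.cons_sublist_cons.1 hs
    rcases h1 with h | h
    · rename_i h; exact hn.2.1 (h.subset (by simp))
    · rename_i h; exact hn.2.1 (h.subset (by simp))
  | cons z A ih =>
    intro hn hs
    rw [List.cons_append, List.nodup_cons] at hn
    rw [List.cons_append] at hs
    refine ih hn.2 ?_
    rcases List.sublist_cons_iff.1 hs with h | ⟨r, h, h'⟩
    · exact h
    · simp only [List.cons.injEq] at h
      exact absurd (by simp [h.1]) hn.1

theorem consec_aux2 {P : Type} {a b c : P} (B : List P) : ∀ A : List P, (A ++ c :: a :: B).Nodup →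
    List.Sublist [a, b, c] (A ++ c :: a :: B) → False := by
  intro A
  induction A with
  | nil =>
    intro hn hs
    simp only [List.nil_append, List.nodup_cons, List.mem_cons, not_or] at hn
    rw [List.nil_append] at hs
    rcases List.sublist_cons_iff.1 hs with h | ⟨r, h, h'⟩
    · have h1 : c ∈ a :: B := h.subset (by simp)
      simp only [List.mem_cons] at h1
      tauto
    · simp only [List.cons.injEq] at h
      exact hn.1.1 h.1.symm
  | cons z A ih =>
    intro hn hs
    rw [List.cons_append, List.nodup_cons] at hn
    rw [List.cons_append] at hs
    refine ih hn.2 ?_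
    rcases List.sublist_cons_iff.1 hs with h | ⟨r, h, h'⟩
    · exact h
    · simp only [List.cons.injEq] at h
      exact absurd (by simp [h.1]) hn.1

/-- Add all consecutive pairs of a list to a relation. -/
def Kn {P : Type} (K : P → P → Prop) (l : List P) (x y : P) : Prop :=
  K x y ∨ [x, y] <:+: l ∨ [y, x] <:+: l

theorem consec {P : Type} {l L : List P} (hl : l <:+: L) (hn : L.Nodup) {a b c : P} (hs : List.Sublist [a, b, c] L)
    (h : [a, c] <:+: l ∨ [c, a] <:+: l) : False := by
  rcases h with h | h
  · obtain ⟨A, B, rfl⟩ := h.trans hl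
    exact consec_aux1 B A (by simpa using hn) (by simpa using hs)
  · obtain ⟨A, B, rfl⟩ := h.trans hl
    exact consec_aux2 B A (by simpa using hn) (by simpa using hs)

theorem NC.insert {P : Type} {K : P → P → Prop} {p q : P} {N R : List P} (hn : (p :: N ++ q :: R).Nodup)
    (hK : ∀ x y, K x y → x ∈ p :: q :: R ∧ y ∈ p :: q :: R) (h : NC K (p :: q :: R)) :
    NC (Kn K (p :: N ++ [q])) (p :: N ++ q :: R) := by
  classical
  rintro a b c d hs ⟨h1, h2⟩
  have hl : (p :: N ++ [q]) <:+: (p :: N ++ q :: R) := ⟨[], R, by simp⟩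
  have hs1 : List.Sublist [a, b, c] [a, b, c, d] := by
    have := List.sublist_append_left [a, b, c] [d]; simpa using this
  have hs2 : List.Sublist [b, c, d] [a, b, c, d] := List.sublist_cons_self _ _
  rcases h1 with h1 | h1
  · rcases h2 with h2 | h2
    · refine h a b c d ?_ ⟨h1, h2⟩
      have hf := hs.filter (fun x => decide (x ∉ N))
      have hN : ∀ x ∈ p :: q :: R, x ∉ N := by
        intro x hx hx'
        simp only [List.cons_append, List.nodup_cons, List.mem_append, List.nodup_append, List.mem_cons] at hn hx
        rcases hx with rfl | hx
        · exact hn.1 (Or.inl hx')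
        · exact hn.2.2.2 x hx' x hx rfl
      have e1 : [a, b, c, d].filter (fun x => decide (x ∉ N)) = [a, b, c, d] := by
        rw [List.filter_eq_self]
        intro x hx
        simp only [List.mem_cons, List.not_mem_nil, or_false] at hx
        refine decide_eq_true (hN x ?_)
        rcases hx with rfl | rfl | rfl | rfl
        · exact (hK _ _ h1).1
        · exact (hK _ _ h2).1
        · exact (hK _ _ h1).2
        · exact (hK _ _ h2).2
      have e2 : (p :: N ++ q :: R).filter (fun x => decide (x ∉ N)) = p :: q :: R := by
        rw [List.filter_append, List.filter_cons_of_pos (p := fun x => decide (x ∉ N)) (a := p) (decide_eq_true (hN p (by simp)))]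
        have e3 : N.filter (fun x => decide (x ∉ N)) = [] := by
          rw [List.filter_eq_nil_iff]; intro x hx; simp [hx]
        have e4 : (q :: R).filter (fun x => decide (x ∉ N)) = q :: R := by
          rw [List.filter_eq_self]
          intro x hx
          exact decide_eq_true (hN x (by simp at hx ⊢; tauto))
        rw [e3, e4]; simp
      rw [e1, e2] at hf
      exact hf
    · exact consec hl hn (hs2.trans hs) h2
  · exact consec hl hn (hs1.trans hs) h1

variable {V E : Type}

/-- A side of the polygon is compatible with its ends. -/
def SideOK (M : Multigraph V E) (x y : (V × ℕ) × Option E) : Prop :=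
  (x.2 = none → x.1.1 = y.1.1) ∧ ∀ e, x.2 = some e → M.ends e = s(x.1.1, y.1.1)

/-- A polygon. -/
structure Geo (M : Multigraph V E) (L : List ((V × ℕ) × Option E)) (K : V × ℕ → V × ℕ → Prop) (b : ℕ) : Prop where
  len : 3 ≤ L.length
  nd : (L.map Prod.fst).Nodup
  bd : ∀ x ∈ L, x.1.2 < b
  cyc : Cycle.Chain (SideOK M) (L : Cycle _)
  nc : NC K (L.map Prod.fst)
  ks : ∀ x y, K x y → K y x
  kin : ∀ x y, K x y → x ∈ L.map Prod.fst ∧ y ∈ L.map Prod.fst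

theorem Geo.rot {M : Multigraph V E} {L1 L2 K b} (h : Geo M (L1 ++ L2) K b) : Geo M (L2 ++ L1) K b where
  len := by have := h.len; simp at this ⊢; omega
  nd := by have := h.nd; rw [List.map_append] at this ⊢; exact List.nodup_append_comm.1 this
  bd := fun x hx => h.bd x (by simp at hx ⊢; tauto)
  cyc := by
    have : ((L2 ++ L1 : List _) : Cycle ((V × ℕ) × Option E)) = ((L1 ++ L2 : List _) : Cycle _) :=
      Quotient.sound List.isRotated_append
    rw [this]; exact h.cyc
  nc := by have := h.nc; rw [List.map_append] at this ⊢; exact NC.rot h.ks this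
  ks := h.ks
  kin := fun x y hxy => by have := h.kin x y hxy; simp only [List.map_append, List.mem_append] at this ⊢; tauto

/-- A walk in a multigraph as a list. -/
def IsW (M : Multigraph V E) : V → List (V × E) → V → Prop
  | u, [], v => u = v
  | u, (d, e) :: D, v => d = u ∧ ∃ w, M.ends e = s(u, w) ∧ IsW M w D v

theorem IsW.append {M : Multigraph V E} : ∀ {D u w D' v}, IsW M u D w → IsW M w D' v → IsW M u (D ++ D') v := by
  intro D
  induction D with
  | nil => intro u w D' v h h'; cases h; exact h'
  | cons x D ih =>
    rintro u w D' v ⟨h1, y, h2, h3⟩ h'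
    exact ⟨h1, y, h2, ih h3 h'⟩

theorem IsW.rev {M : Multigraph V E} : ∀ {D u v}, IsW M u D v →
    ∃ D', IsW M v D' u ∧ List.Perm (D'.map Prod.snd) (D.map Prod.snd) := by
  intro D
  induction D with
  | nil => intro u v h; cases h; exact ⟨[], rfl, by simp⟩
  | cons x D ih =>
    rintro u v ⟨h1, y, h2, h3⟩
    obtain ⟨D', h4, h5⟩ := ih h3
    refine ⟨D' ++ [(y, x.2)], h4.append ⟨rfl, u, by rw [h2]; exact Sym2.eq_swap, rfl⟩, ?_⟩
    rw [List.map_append, List.map_cons, List.map_cons, List.map_nil]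
    exact (List.perm_append_singleton _ _).trans (h5.cons _)

/-- New polygon sides along a walk. -/
def mkS : ℕ → List (V × E) → List ((V × ℕ) × Option E)
  | _, [] => []
  | b, (d, e) :: D => ((d, b), some e) :: mkS (b + 1) D

theorem mkS_bd : ∀ (D : List (V × E)) (b : ℕ), ∀ x ∈ mkS b D, b ≤ x.1.2 ∧ x.1.2 < b + D.length := by
  intro D
  induction D with
  | nil => intro b x hx; simp [mkS] at hx
  | cons y D ih =>
    intro b x hx
    simp only [mkS, List.mem_cons] at hx
    rcases hx with rfl | hx
    · simp
    · have := ih (b + 1) x hx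
      simp only [List.length_cons]
      omega

theorem mkS_nd : ∀ (D : List (V × E)) (b : ℕ), ((mkS b D).map Prod.fst).Nodup := by
  intro D
  induction D with
  | nil => intro b; simp [mkS]
  | cons y D ih =>
    intro b
    rw [mkS, List.map_cons, List.nodup_cons]
    refine ⟨?_, ih _⟩
    intro h
    obtain ⟨x, hx, h⟩ := List.mem_map.1 h
    have := mkS_bd D (b + 1) x hx
    rw [h] at this
    simp at this

theorem mkS_snd (D : List (V × E)) : ∀ b, (mkS b D).map Prod.snd = D.map (fun x => some x.2) := by
  induction D with
  | nil => intro b; simp [mkS]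
  | cons y D ih => intro b; simp [mkS, ih]

theorem mkS_chain {M : Multigraph V E} {q : (V × ℕ) × Option E} {t : List ((V × ℕ) × Option E)}
    (ht : List.IsChain (SideOK M) (q :: t)) : ∀ (D : List (V × E)) (u : V) (b : ℕ), IsW M u D q.1.1 →
    ∃ y s, mkS b D ++ q :: t = y :: s ∧ y.1.1 = u ∧ List.IsChain (SideOK M) (y :: s) := by
  intro D
  induction D with
  | nil => intro u b h; exact ⟨q, t, rfl, h.symm, ht⟩
  | cons x D ih =>
    rintro u b ⟨h1, w, h2, h3⟩
    obtain ⟨y, s, e, h4, h5⟩ := ih w (b + 1) h3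
    refine ⟨((x.1, b), some x.2), y :: s, by rw [mkS, List.cons_append, e], h1, ?_⟩
    refine List.isChain_cons_cons.2 ⟨⟨by simp, ?_⟩, h5⟩
    intro e' he'
    cases he'
    rw [h4, h2]
    change s(u, w) = s(x.1, w)
    rw [h1]

theorem mkS_K {M : Multigraph V E} {q : V × ℕ} : ∀ (D : List (V × E)) (u : V) (b : ℕ), IsW M u D q.1 →
    ∃ y s, (mkS b D).map Prod.fst ++ [q] = y :: s ∧ y.1 = u ∧
    ∀ e ∈ D.map Prod.snd, ∃ x y, [x, y] <:+: (mkS b D).map Prod.fst ++ [q] ∧ M.ends e = s(x.1, y.1) := by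
  intro D
  induction D with
  | nil => intro u b h; exact ⟨q, [], rfl, h.symm, by simp⟩
  | cons x D ih =>
    rintro u b ⟨h1, w, h2, h3⟩
    obtain ⟨y, s, e, h4, h5⟩ := ih w (b + 1) h3
    refine ⟨(x.1, b), y :: s, by rw [mkS, List.map_cons, List.cons_append, e], h1, ?_⟩
    intro e' he'
    rw [mkS, List.map_cons, List.cons_append]
    rw [List.map_cons, List.mem_cons] at he'
    rcases he' with rfl | he'
    · refine ⟨(x.1, b), y, ?_, ?_⟩
      · rw [e]; exact ⟨[], s, by simp⟩
      · rw [h4]; change M.ends x.2 = s(x.1, w)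
        rw [h1]; exact h2
    · obtain ⟨x', y', h6, h7⟩ := h5 e' he'
      exact ⟨x', y', h6.trans (List.suffix_cons _ _).isInfix, h7⟩

theorem Geo.insert {M : Multigraph V E} {p : V × ℕ} {se : Option E} {q : (V × ℕ) × Option E} {R K b}
    (h : Geo M ((p, se) :: q :: R) K b) {D : List (V × E)} (hD : IsW M p.1 D q.1.1) :
    ∃ K' b', Geo M ((p, none) :: mkS b D ++ q :: R) K' b' ∧ (∀ x y, K x y → K' x y) ∧
      ∀ e ∈ D.map Prod.snd, ∃ x y, K' x y ∧ M.ends e = s(x.1, y.1) := by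
  have hnd : (p :: (mkS b D).map Prod.fst ++ q.1 :: R.map Prod.fst).Nodup := by
    have h1 := h.nd
    have h2 := mkS_nd D b
    have h3 : ∀ x ∈ p :: q.1 :: R.map Prod.fst, x.2 < b := by
      intro x hx
      have : x ∈ ((p, se) :: q :: R).map Prod.fst := hx
      obtain ⟨y, hy, rfl⟩ := List.mem_map.1 this
      exact h.bd y hy
    have h4 : ∀ x ∈ (mkS b D).map Prod.fst, b ≤ x.2 := by
      intro x hx
      obtain ⟨y, hy, rfl⟩ := List.mem_map.1 hx
      exact (mkS_bd D b y hy).1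
    have h5 : (p :: q.1 :: R.map Prod.fst).Nodup := h1
    rw [List.nodup_cons] at h5
    rw [List.cons_append, List.nodup_cons, List.mem_append, List.nodup_append]
    refine ⟨?_, h2, h5.2, ?_⟩
    · rintro (hp | hp)
      · have := h4 p hp
        have := h3 p (by simp)
        omega
      · exact h5.1 hp
    · intro x hx y hy hxy
      subst hxy
      have := h4 x hx
      have := h3 x (List.mem_cons_of_mem _ hy)
      omega
  refine ⟨Kn K (p :: (mkS b D).map Prod.fst ++ [q.1]), b + D.length, ⟨?_, ?_, ?_, ?_, ?_, ?_, ?_⟩, fun x y h => Or.inl h, ?_⟩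
  · have := h.len
    simp at this ⊢; omega
  · simpa using hnd
  · intro x hx
    simp only [List.cons_append, List.mem_cons, List.mem_append] at hx
    rcases hx with rfl | hx | hx
    · have := h.bd (p, se) (by simp)
      change p.2 < _
      change p.2 < _ at this
      omega
    · exact (mkS_bd D b x hx).2
    · have := h.bd x (by simp; tauto)
      omega
  · have h1 := h.cyc
    rw [Cycle.chain_coe_cons, List.isChain_cons] at h1
    have h2 : List.IsChain (SideOK M) (q :: (R ++ [(p, none)])) := by
      have h3 : List.IsChain (SideOK M) ((q :: R) ++ [(p, se)]) := h1.2
      rw [List.isChain_append] at h3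
      have : List.IsChain (SideOK M) ((q :: R) ++ [(p, none)]) := by
        rw [List.isChain_append]
        refine ⟨h3.1, by simp, ?_⟩
        intro x hx y hy
        simp at hy
        subst hy
        exact h3.2.2 x hx (p, se) (by simp)
      exact this
    obtain ⟨y, s, e, h3, h4⟩ := mkS_chain h2 D p.1 b hD
    rw [List.cons_append, Cycle.chain_coe_cons, List.append_assoc, List.cons_append, e]
    refine List.isChain_cons_cons.2 ⟨⟨fun _ => h3.symm, by simp⟩, h4⟩
  · have := NC.insert (K := K) hnd (fun x y hxy => h.kin x y hxy) h.nc
    simpa using this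
  · rintro x y (h1 | h1 | h1)
    · exact Or.inl (h.ks _ _ h1)
    · exact Or.inr (Or.inr h1)
    · exact Or.inr (Or.inl h1)
  · have hsub : ∀ z ∈ p :: (mkS b D).map Prod.fst ++ [q.1], z ∈ ((p, none) :: mkS b D ++ q :: R).map Prod.fst := by
      intro z hz
      simp only [List.cons_append, List.map_cons, List.map_append, List.mem_cons, List.mem_append, List.not_mem_nil, or_false] at hz ⊢
      tauto
    rintro x y (h1 | h1 | h1)
    · have := h.kin x y h1
      simp only [List.cons_append, List.map_cons, List.map_append, List.mem_cons, List.mem_append] at this ⊢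
      tauto
    · exact ⟨hsub x (h1.subset (by simp)), hsub y (h1.subset (by simp))⟩
    · exact ⟨hsub x (h1.subset (by simp)), hsub y (h1.subset (by simp))⟩
  · intro e he
    obtain ⟨_, _, _, _, h1⟩ := mkS_K (q := q.1) D p.1 b hD
    obtain ⟨x, y, h2, h3⟩ := h1 e he
    exact ⟨x, y, Or.inr (Or.inl (h2.trans (List.suffix_cons _ _).isInfix)), h3⟩

end Polygon



/-! ### Cutting a surface open -/

section Cut

variable {V E F : Type} {M : Multigraph V E}

open Multigraph

/-- A segment of a closed walk. -/
def Multigraph.CWalk.seg (W : M.CWalk) (s m : ℕ) : List (V × E) := (List.range' s m).map (fun k => (W.vtx k, W.edge k))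

theorem Multigraph.CWalk.seg_isW (W : M.CWalk) : ∀ m s, IsW M (W.vtx s) (W.seg s m) (W.vtx (s + m)) := by
  intro m
  induction m with
  | zero => intro s; rfl
  | succ m ih =>
    intro s
    have := ih (s + 1)
    rw [show s + 1 + m = s + (m + 1) by omega] at this
    exact ⟨rfl, _, W.compat s, this⟩

open Classical in
theorem Multigraph.CWalk.seg_count (W : M.CWalk) (e : E) : ∀ s, ((W.seg s W.len).map Prod.snd).count e = W.cnt e := by
  have hm : ∀ s m, (W.seg s m).map Prod.snd = (List.range' s m).map W.edge := by
    intro s m; simp [CWalk.seg]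
  intro s
  rw [hm]
  induction s with
  | zero =>
    rw [← List.range_eq_range', CWalk.cnt, List.count, List.countP_map, List.countP_eq_length_filter]
    rw [Finset.card_def, Finset.filter_val, Finset.range_val]
    change _ = (Multiset.filter _ ((List.range W.len : List ℕ) : Multiset ℕ)).card
    rw [Multiset.filter_coe, Multiset.coe_card]
    congr 2
  | succ s ih =>
    rw [← ih]
    have h1 : List.range' s (W.len + 1) = s :: List.range' (s + 1) W.len := rfl
    have h2 : List.range' s (W.len + 1) = List.range' s W.len ++ [s + W.len] := by
      rw [List.range'_concat]; simp
    have h3 : ((List.range' s (W.len + 1)).map W.edge).count e = ((List.range' s (W.len + 1)).map W.edge).count e := rfl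
    conv_lhs at h3 => rw [h1]
    conv_rhs at h3 => rw [h2]
    rw [List.map_cons, List.map_append, List.map_cons, List.map_nil, W.edge_per s, List.count_append, List.count_cons, List.count_cons,
      List.count_nil] at h3
    omega

open Classical in
/-- A polygon obtained by cutting the surface, covering the faces in `S`. -/
structure Pol (emb : M.Embedding F) (T : RT V) (te : V → E) (S : Finset F) (U : Finset E)
    (L : List ((V × ℕ) × Option E)) (K : V × ℕ → V × ℕ → Prop) : Prop where
  geo : ∃ b, Geo M L K b
  cnt : ∀ e, (L.map Prod.snd).count (some e) = if e ∈ U then 0 else ∑ f ∈ S, (emb.boundary f).cnt e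
  hK : ∀ e, ∀ f ∈ S, 0 < (emb.boundary f).cnt e → ∃ x y, K x y ∧ M.ends e = s(x.1, y.1)
  cu : U.card + 1 = S.card
  ut : ∀ e ∈ U, ∀ v, v ≠ T.r → te v ≠ e
  u2 : ∀ e ∈ U, ∑ f ∈ S, (emb.boundary f).cnt e = 2

open Classical in
theorem count_ins {p : V × ℕ} {D : List (V × E)} {b : ℕ} {R : List ((V × ℕ) × Option E)} (e : E) :
    (((p, none) :: mkS b D ++ R).map Prod.snd).count (some e) = (D.map Prod.snd).count e + (R.map Prod.snd).count (some e) := by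
  rw [List.map_append, List.map_cons, mkS_snd, List.count_append, List.count_cons]
  have : D.map (fun x => some x.2) = (D.map Prod.snd).map some := by simp
  rw [this, List.count_map_of_injective _ _ (Option.some_injective E)]
  simp

theorem Pol.start (emb : M.Embedding F) (T : RT V) (te : V → E) (f : F) : ∃ L K, Pol emb T te {f} ∅ L K := by
  classical
  have g0 : ∀ v : V, Geo M [((v, 0), none), ((v, 1), none), ((v, 2), none)] (fun _ _ => False) 3 := by
    intro v
    refine ⟨by simp, by simp, by simp, ?_, ?_, by simp, by simp⟩
    · rw [Cycle.chain_coe_cons]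
      simp [SideOK]
    · rintro a b c d _ ⟨h, _⟩
      exact h
  have hw := (emb.boundary f).seg_isW (emb.boundary f).len 0
  rw [Nat.zero_add] at hw
  have h4 : (emb.boundary f).vtx (emb.boundary f).len = (emb.boundary f).vtx 0 := by simpa using (emb.boundary f).vtx_per 0
  rw [h4] at hw
  obtain ⟨K, b, h1, h2, h3⟩ := (g0 ((emb.boundary f).vtx 0)).insert hw
  refine ⟨_, K, ⟨b, h1⟩, ?_, ?_, by simp, by simp, by simp⟩
  · intro e
    rw [count_ins]
    simp [CWalk.seg_count]
  · intro e f' hf' he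
    rw [Finset.mem_singleton] at hf'
    subst hf'
    apply h3
    rw [← List.count_pos_iff, CWalk.seg_count]
    exact he

theorem Pol.step [Finite V] [Finite E] [Fintype F] {emb : M.Embedding F} {T : RT V} {te : V → E} (hT : TE M T te) {S U L K}
    (h : Pol emb T te S U L K) (hS : S.card < Fintype.card F) :
    ∃ S' U' L' K', Pol emb T te S' U' L' K' ∧ S'.card = S.card + 1 := by
  classical
  obtain ⟨f1, hf1⟩ : ∃ f, f ∈ S := by
    have := h.cu
    exact Finset.card_pos.1 (by omega)
  obtain ⟨f2, hf2⟩ : ∃ f, f ∉ S := by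
    by_contra hc
    push Not at hc
    rw [Finset.card_eq_of_equiv_fin (Fintype.equivFinOfCardEq rfl |>.symm |> fun e => (Equiv.subtypeUnivEquiv hc).trans e.symm)] at hS
    omega
  obtain ⟨e, he, p, p', hp, hp', hpS, hpS'⟩ : ∃ e, (∀ v, v ≠ T.r → te v ≠ e) ∧ ∃ p p', IsOcc emb.boundary e p ∧
      IsOcc emb.boundary e p' ∧ p.1 ∈ S ∧ p'.1 ∉ S := by
    by_contra hc
    push Not at hc
    exact hf2 (dual_conn emb hT (fun f => f ∈ S) (fun e he p p' hp hp' hs => hc e he p p' hp hp' hs) f1 f2 hf1)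
  have c1 : 0 < (emb.boundary p.1).cnt e := (CWalk.cnt_pos _ _).2 ⟨p.2, hp⟩
  have c2 : 0 < (emb.boundary p'.1).cnt e := (CWalk.cnt_pos _ _).2 ⟨p'.2, hp'⟩
  have s1 : (emb.boundary p.1).cnt e ≤ ∑ f ∈ S, (emb.boundary f).cnt e :=
    Finset.single_le_sum (f := fun f => (emb.boundary f).cnt e) (fun _ _ => Nat.zero_le _) hpS
  have s2 : ∑ f ∈ insert p'.1 S, (emb.boundary f).cnt e ≤ 2 := by
    rw [← emb.sum_cnt e]
    exact Finset.sum_le_sum_of_subset (Finset.subset_univ _)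
  rw [Finset.sum_insert hpS'] at s2
  have heU : e ∉ U := by
    intro hU
    have := h.u2 e hU
    omega
  have hc := h.cnt e
  rw [if_neg heU] at hc
  have hm : some e ∈ L.map Prod.snd := by
    rw [← List.count_pos_iff]; omega
  obtain ⟨x, hx, hxe⟩ := List.mem_map.1 hm
  obtain ⟨L1, L2, rfl⟩ := List.append_of_mem hx
  obtain ⟨⟨v, k⟩, se⟩ := x
  change se = some e at hxe
  subst hxe
  obtain ⟨b, hg⟩ := h.geo
  have hg' := hg.rot
  have hq : L2 ++ L1 ≠ [] := by
    intro h0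
    have := hg'.len
    rw [List.cons_append, h0] at this
    simp at this
  obtain ⟨q, R, hqR⟩ := List.exists_cons_of_ne_nil hq
  rw [List.cons_append, hqR] at hg'
  have hends : M.ends e = s(v, q.1.1) := by
    have := hg'.cyc
    rw [Cycle.chain_coe_cons, List.cons_append, List.isChain_cons_cons] at this
    exact this.1.2 e rfl
  -- the walk around the new face
  obtain ⟨D, hD, hDc⟩ : ∃ D, IsW M v D q.1.1 ∧ ∀ e', (D.map Prod.snd).count e' + (if e = e' then 1 else 0) = (emb.boundary p'.1).cnt e' := by
    have hl := (emb.boundary p'.1).len_pos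
    obtain ⟨m, hm⟩ : ∃ m, (emb.boundary p'.1).len = m + 1 := ⟨(emb.boundary p'.1).len - 1, by omega⟩
    have hw := (emb.boundary p'.1).seg_isW m (p'.2 + 1)
    rw [show p'.2 + 1 + m = p'.2 + (emb.boundary p'.1).len by omega, CWalk.vtx_per] at hw
    have hcn : ∀ e', (((emb.boundary p'.1).seg (p'.2 + 1) m).map Prod.snd).count e' + (if e = e' then 1 else 0) =
        (emb.boundary p'.1).cnt e' := by
      intro e'
      rw [← (emb.boundary p'.1).seg_count e' p'.2, hm]
      change _ = (((emb.boundary p'.1).edge p'.2) :: ((emb.boundary p'.1).seg (p'.2 + 1) m).map Prod.snd).count e'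
      rw [hp'.2, List.count_cons]
      simp
    have h1 := (emb.boundary p'.1).compat p'.2
    rw [hp'.2, hends] at h1
    rcases Sym2.eq_iff.1 h1 with ⟨h2, h3⟩ | ⟨h2, h3⟩
    · obtain ⟨D', hD', hperm⟩ := hw.rev
      rw [← h2, ← h3] at hD'
      exact ⟨D', hD', fun e' => by rw [hperm.count_eq, hcn]⟩
    · rw [← h2, ← h3] at hw
      exact ⟨_, hw, hcn⟩
  obtain ⟨K', b', g1, g2, g3⟩ := hg'.insert hD
  have hcS : ∀ e', ∑ f ∈ insert p'.1 S, (emb.boundary f).cnt e' = (emb.boundary p'.1).cnt e' + ∑ f ∈ S, (emb.boundary f).cnt e' :=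
    fun e' => Finset.sum_insert hpS'
  have hle : ∀ e', ∑ f ∈ insert p'.1 S, (emb.boundary f).cnt e' ≤ 2 := by
    intro e'
    rw [← emb.sum_cnt e']
    exact Finset.sum_le_sum_of_subset (Finset.subset_univ _)
  refine ⟨insert p'.1 S, insert e U, _, K', ⟨⟨b', g1⟩, ?_, ?_, ?_, ?_, ?_⟩, ?_⟩
  · intro e'
    rw [count_ins]
    have h1 := h.cnt e'
    have h2 : ((q :: R).map Prod.snd).count (some e') + (if e = e' then 1 else 0) =
        ((L1 ++ ((v, k), some e) :: L2).map Prod.snd).count (some e') := by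
      rw [← hqR]
      simp only [List.map_append, List.map_cons, List.count_append, List.count_cons, beq_iff_eq, Option.some.injEq]
      omega
    have h3 := hDc e'
    have h4 := hcS e'
    have h5 := hle e'
    have h6 := h.u2 e'
    rw [h1] at h2
    have hmi := Finset.mem_insert (a := e') (b := e) (s := U)
    by_cases hee : e = e'
    · subst hee
      rw [if_pos (hmi.2 (Or.inl rfl))]
      simp only [if_true] at h2 h3
      rw [if_neg heU] at h2
      omega
    · rw [if_neg hee] at h2 h3
      by_cases hU : e' ∈ U
      · rw [if_pos (hmi.2 (Or.inr hU))]
        rw [if_pos hU] at h2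
        have := h6 hU
        omega
      · rw [if_neg (fun hi => (hmi.1 hi).elim (fun h => hee h.symm) hU)]
        rw [if_neg hU] at h2
        omega
  · intro e' f hf he'
    have old : ∀ f ∈ S, 0 < (emb.boundary f).cnt e' → ∃ x y, K' x y ∧ M.ends e' = s(x.1, y.1) := by
      intro f hf he'
      obtain ⟨x, y, h1, h2⟩ := h.hK e' f hf he'
      exact ⟨x, y, g2 x y h1, h2⟩
    rcases Finset.mem_insert.1 hf with rfl | hf
    · by_cases hee : e = e'
      · subst hee
        exact old p.1 hpS c1
      · apply g3
        have := hDc e'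
        rw [if_neg hee] at this
        rw [← List.count_pos_iff]; omega
    · exact old f hf he'
  · rw [Finset.card_insert_of_notMem heU, Finset.card_insert_of_notMem hpS', h.cu]
  · intro e' he'
    rcases Finset.mem_insert.1 he' with rfl | he'
    · exact he
    · exact h.ut e' he'
  · intro e' he'
    have h4 := hcS e'
    have h5 := hle e'
    rcases Finset.mem_insert.1 he' with rfl | he'
    · omega
    · have := h.u2 e' he'
      omega
  · rw [Finset.card_insert_of_notMem hpS']

theorem Pol.full [Finite V] [Finite E] [Fintype F] (emb : M.Embedding F) {T : RT V} {te : V → E} (hT : TE M T te) (f : F) :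
    ∃ U L K, Pol emb T te Finset.univ U L K := by
  have : ∀ k, ∃ S U L K, Pol emb T te S U L K ∧ (S.card = Fintype.card F ∨ k < S.card) := by
    intro k
    induction k with
    | zero =>
      obtain ⟨L, K, h⟩ := Pol.start emb T te f
      exact ⟨_, _, L, K, h, Or.inr (by simp)⟩
    | succ k ih =>
      obtain ⟨S, U, L, K, h, h1⟩ := ih
      by_cases hS : S.card = Fintype.card F
      · exact ⟨S, U, L, K, h, Or.inl hS⟩
      · obtain ⟨S', U', L', K', h', h2⟩ := h.step hT (lt_of_le_of_ne (Finset.card_le_univ S) hS)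
        exact ⟨S', U', L', K', h', Or.inr (by have := h1.resolve_left hS; omega)⟩
  obtain ⟨S, U, L, K, h, h1⟩ := this (Fintype.card F)
  have h2 : S = Finset.univ := by
    rw [← Finset.card_eq_iff_eq_univ]
    have := Finset.card_le_univ S
    omega
  subst h2
  exact ⟨U, L, K, h⟩

end Cut



/-! ### Assembly -/

section Assembly

open Multigraph

theorem cross {α : Type} {S C : α → Prop} : ∀ (m : List α) (x y : α),
    List.IsChain (fun u v => (S u ↔ S v) ∨ C u) (x :: (m ++ [y])) → ¬ (S x ↔ S y) → ∃ z ∈ x :: m, C z := by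
  intro m
  induction m with
  | nil =>
    intro x y h hn
    rw [List.nil_append, List.isChain_cons_cons] at h
    exact ⟨x, by simp, h.1.resolve_left hn⟩
  | cons a m ih =>
    intro x y h hn
    rw [List.cons_append, List.isChain_cons_cons] at h
    rcases h.1 with h1 | h1
    · obtain ⟨z, hz, hC⟩ := ih a y h.2 (fun h2 => hn (h1.trans h2))
      exact ⟨z, List.mem_cons_of_mem _ hz, hC⟩
    · exact ⟨x, by simp, h1⟩

theorem sub_split {α : Type} {a : α} {l L : List α} (h : List.Sublist (a :: l) L) : ∃ A B, L = A ++ a :: B ∧ List.Sublist l B := by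
  obtain ⟨r1, r2, rfl, h1, h2⟩ := List.cons_sublist_iff.1 h
  obtain ⟨A, B, rfl⟩ := List.append_of_mem h1
  exact ⟨A, B ++ r2, by simp, h2.trans (List.sublist_append_right _ _)⟩

theorem iv_aux {V E : Type} [DecidableEq E] {S : (V × ℕ) × Option E → Prop} {e : E} {L : List ((V × ℕ) × Option E)}
    (hc : List.IsChain (fun u v => (S u ↔ S v) ∨ u.2 = some e) L) (h2 : (L.map Prod.snd).count (some e) ≤ 2)
    {a b c d : (V × ℕ) × Option E} (hs : List.Sublist [a, b, c, d] L) (h1 : ¬ (S a ↔ S b)) (h3 : ¬ (S b ↔ S c))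
    (h4 : ¬ (S c ↔ S d)) : False := by
  obtain ⟨A0, B0, rfl, hs0⟩ := sub_split hs
  obtain ⟨A1, B1, rfl, hs1⟩ := sub_split hs0
  obtain ⟨A2, B2, rfl, hs2⟩ := sub_split hs1
  obtain ⟨A3, B3, rfl, hs3⟩ := sub_split hs2
  have seg : ∀ (x y : (V × ℕ) × Option E) (m : List ((V × ℕ) × Option E)), (x :: (m ++ [y])) <:+: A0 ++ a :: (A1 ++ b :: (A2 ++ c :: (A3 ++ d :: B3))) →
      ¬ (S x ↔ S y) → 0 < ((x :: m).map Prod.snd).count (some e) := by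
    intro x y m hi hn
    obtain ⟨z, hz, hC⟩ := cross m x y (hc.infix hi) hn
    rw [List.count_pos_iff, ← hC]
    exact List.mem_map_of_mem hz
  have k1 := seg a b A1 ⟨A0, A2 ++ c :: (A3 ++ d :: B3), by simp⟩ h1
  have k2 := seg b c A2 ⟨A0 ++ a :: A1, A3 ++ d :: B3, by simp⟩ h3
  have k3 := seg c d A3 ⟨A0 ++ a :: (A1 ++ b :: A2), B3, by simp⟩ h4
  have e1 : A0 ++ a :: (A1 ++ b :: (A2 ++ c :: (A3 ++ d :: B3))) = A0 ++ ((a :: A1) ++ ((b :: A2) ++ ((c :: A3) ++ d :: B3))) := by simp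
  rw [e1] at h2
  simp only [List.map_append, List.count_append] at h2
  omega

theorem RT.anc_root {V : Type} (T : RT V) : ∀ k v, T.dep v ≤ k → T.Anc T.r v := by
  intro k
  induction k with
  | zero =>
    intro v hv
    by_cases hr : v = T.r
    · subst hr; exact T.anc_refl _
    · have := T.dep_par v hr; omega
  | succ k ih =>
    intro v hv
    by_cases hr : v = T.r
    · subst hr; exact T.anc_refl _
    · have := T.dep_par v hr
      exact T.anc_par (ih _ (by omega))

theorem anc_count {V : Type} [Finite V] (T : RT V) (X : Finset V) (d : ℕ) :
    {v | (∃ u ∈ X, T.Anc v u) ∧ T.dep v = d}.ncard ≤ X.card := by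
  classical
  have : ∀ v, ∃ u, (∃ u ∈ X, T.Anc v u) ∧ T.dep v = d → u ∈ X ∧ T.Anc v u := by
    intro v
    by_cases h : (∃ u ∈ X, T.Anc v u) ∧ T.dep v = d
    · obtain ⟨⟨u, hu⟩, _⟩ := h
      exact ⟨u, fun _ => hu⟩
    · exact ⟨v, fun h' => absurd h' h⟩
  choose f hf using this
  rw [← Set.ncard_coe_finset]
  refine Set.ncard_le_ncard_of_injOn f (fun v hv => (hf v hv).1) ?_ (Set.toFinite _)
  intro v hv w hw hvw
  have h1 := (hf v hv).2
  have h2 := (hf w hw).2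
  rw [hvw] at h1
  exact T.anc_uniq h1 h2 (hv.2.trans hw.2.symm)

theorem idx_exists {V κ : Type} [Finite V] (f : V → κ) (m : ℕ) (h : ∀ k, {v | f v = k}.ncard ≤ m) :
    ∃ idx : V → Fin m, ∀ u v, f u = f v → idx u = idx v → u = v := by
  have : ∀ k, ∃ g : {v | f v = k} → Fin m, Function.Injective g := by
    intro k
    have hk : Nat.card {v | f v = k} ≤ m := by rw [Nat.card_coe_set_eq]; exact h k
    exact ⟨fun v => Fin.castLE hk (Finite.equivFin _ v), fun u v huv => (Finite.equivFin _).injective (Fin.castLE_injective hk huv)⟩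
  choose g hg using this
  refine ⟨fun v => g (f v) ⟨v, rfl⟩, ?_⟩
  intro u v huv hi
  have aux : ∀ (k : κ) (h : f v = k), g (f v) ⟨v, rfl⟩ = g k ⟨v, h⟩ := by
    rintro k rfl; rfl
  change g (f u) ⟨u, rfl⟩ = g (f v) ⟨v, rfl⟩ at hi
  rw [aux (f u) huv.symm] at hi
  exact congrArg Subtype.val (hg _ hi)

end Assembly



section Main

open Multigraph

theorem sym2_card_le {V : Type} [DecidableEq V] (z : Sym2 V) : z.toFinset.card ≤ 2 := by
  induction z with
  | _ x y => rw [Sym2.toFinset_mk_eq]; exact Finset.card_le_two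

theorem exists_col {V E F : Type} [Finite V] [Finite E] [Finite F] (M : Multigraph V E) (emb : M.Embedding F) (hE : Nonempty E)
    (g : ℕ) (hg : emb.eulerGenus ≤ g) :
    ∃ (n : ℕ) (A : ℕ → ℕ → Prop) (col dep : V → ℕ), HS n A [] ∧ (∀ v : V, col v < n) ∧
      (∀ c d, {v | col v = c ∧ dep v = d}.ncard ≤ max (2 * g) 3) ∧
      ∀ u v, M.simple.Adj u v → (dep u ≤ dep v + 1 ∧ dep v ≤ dep u + 1) ∧ (col u = col v ∨ A (col u) (col v)) := by
  classical
  have := Fintype.ofFinite V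
  have := Fintype.ofFinite E
  have := Fintype.ofFinite F
  obtain ⟨T, te, hT, hdep⟩ := exists_tree M emb.conn hE
  obtain ⟨e0⟩ := hE
  obtain ⟨p0, -⟩ := emb.exists_occ e0
  obtain ⟨U, L, K, h⟩ := Pol.full emb hT p0.1
  obtain ⟨b, geo⟩ := h.geo
  let TS : Finset E := (Finset.univ.filter (fun v => v ≠ T.r)).image te
  have hTS : TS.card + 1 = Fintype.card V := by
    rw [Finset.card_image_of_injOn, Finset.filter_ne', Finset.card_erase_of_mem (Finset.mem_univ _), Finset.card_univ]
    · have : 0 < Fintype.card V := Fintype.card_pos_iff.2 ⟨T.r⟩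
      omega
    · intro v hv w hw
      simp at hv hw
      exact hT.inj hv hw
  have mTS : ∀ e, e ∈ TS ↔ ∃ v, v ≠ T.r ∧ te v = e := by
    intro e; simp [TS]
  have hdisj : Disjoint U TS := by
    rw [Finset.disjoint_left]
    intro e he he'
    obtain ⟨v, hv, hve⟩ := (mTS e).1 he'
    exact h.ut e he v hv hve
  let X : Finset E := (U ∪ TS)ᶜ
  have hX : X.card ≤ g := by
    have h1 := Finset.card_add_card_compl (U ∪ TS)
    rw [Finset.card_union_of_disjoint hdisj] at h1
    have h2 := h.cu
    rw [Finset.card_univ] at h2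
    unfold Embedding.eulerGenus at hg
    rw [Nat.card_eq_fintype_card, Nat.card_eq_fintype_card, Nat.card_eq_fintype_card] at hg
    have h3 : X.card = (U ∪ TS)ᶜ.card := rfl
    omega
  let Y : Finset V := X.biUnion (fun e => (M.ends e).toFinset)
  have hY : Y.card ≤ 2 * g := by
    have := Finset.card_biUnion_le_card_mul X (fun e => (M.ends e).toFinset) 2 (fun e _ => sym2_card_le _)
    have h3 : Y.card = (X.biUnion (fun e => (M.ends e).toFinset)).card := rfl
    omega
  have mY : ∀ e ∈ X, ∀ u ∈ M.ends e, u ∈ Y := by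
    intro e he u hu
    exact Finset.mem_biUnion.2 ⟨e, he, Sym2.mem_toFinset.2 hu⟩
  let Z : V → Prop := fun v => v = T.r ∨ ∃ u ∈ Y, T.Anc v u
  have hcl : ∀ v, Z v → Z (T.par v) := by
    rintro v (rfl | ⟨u, hu, hv⟩)
    · exact Or.inl T.par_r
    · exact Or.inr ⟨u, hu, T.par_anc hv⟩
  have hcnt : ∀ d, {v | Z v ∧ T.dep v = d}.ncard ≤ max (2 * g) 3 := by
    intro d
    by_cases hne : Y.Nonempty
    · obtain ⟨y, hy⟩ := hne
      have hsub : {v | Z v ∧ T.dep v = d} ⊆ {v | (∃ u ∈ Y, T.Anc v u) ∧ T.dep v = d} := by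
        rintro v ⟨rfl | hv, hd⟩
        · exact ⟨⟨y, hy, T.anc_root _ y le_rfl⟩, hd⟩
        · exact ⟨hv, hd⟩
      exact (Set.ncard_le_ncard hsub (Set.toFinite _)).trans ((anc_count T Y d).trans (hY.trans (le_max_left _ _)))
    · have hsub : {v | Z v ∧ T.dep v = d} ⊆ {T.r} := by
        rintro v ⟨rfl | ⟨u, hu, _⟩, hd⟩
        · rfl
        · exact absurd ⟨u, hu⟩ hne
      refine (Set.ncard_le_ncard hsub (Set.toFinite _)).trans ?_
      rw [Set.ncard_singleton]
      exact le_trans (by norm_num) (le_max_right _ _)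
  have hcL : List.IsChain (SideOK M) L := by
    have h1 := geo.cyc
    cases L with
    | nil => simp
    | cons a l =>
      rw [Cycle.chain_coe_cons] at h1
      exact (List.isChain_append.1 (show List.IsChain (SideOK M) ((a :: l) ++ [a]) from h1)).1
  have hiv : ∀ w, ¬ Z w → IV (fun p : V × ℕ => T.Anc w p.1) (L.map Prod.fst) := by
    intro w hw
    have hwr : w ≠ T.r := fun h => hw (Or.inl h)
    have hc2 : (L.map Prod.snd).count (some (te w)) ≤ 2 := by
      rw [h.cnt (te w), emb.sum_cnt]
      split_ifs <;> omega
    have hch : List.IsChain (fun u v => (T.Anc w u.1.1 ↔ T.Anc w v.1.1) ∨ u.2 = some (te w)) L := by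
      have hmem : ∀ x ∈ L, ∀ e, x.2 = some e → e ∉ U := by
        intro x hx e hxe hU
        have h1 := h.cnt e
        rw [if_pos hU, List.count_eq_zero] at h1
        exact h1 (List.mem_map.2 ⟨x, hx, hxe⟩)
      have hP : ∀ x ∈ L, ∀ y, SideOK M x y → (T.Anc w x.1.1 ↔ T.Anc w y.1.1) ∨ x.2 = some (te w) := by
        intro x hx y hxy
        rcases hxe : x.2 with _ | e
        · left; rw [hxy.1 hxe]
        · have h1 := hxy.2 e hxe
          have h2 := hmem x hx e hxe
          by_cases h3 : e ∈ TS
          · obtain ⟨v, hv, rfl⟩ := (mTS e).1 h3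
            by_cases hvw : v = w
            · right; rw [hvw]
            · left
              have h4 : T.Anc w v ↔ T.Anc w (T.par v) := by
                constructor
                · intro h5
                  exact (T.anc_cases h5).resolve_left (fun h6 => hvw h6.symm)
                · exact T.anc_par
              rw [hT v hv] at h1
              rcases Sym2.eq_iff.1 h1 with ⟨h5, h6⟩ | ⟨h5, h6⟩
              · rw [← h5, ← h6]; exact h4
              · rw [← h5, ← h6]; exact h4.symm
          · left
            have hXe : e ∈ X := by simp [X, h2, h3]
            have n1 : ¬ T.Anc w x.1.1 := fun h5 => hw (Or.inr ⟨_, mY e hXe x.1.1 (by rw [h1]; simp), h5⟩)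
            have n2 : ¬ T.Anc w y.1.1 := fun h5 => hw (Or.inr ⟨_, mY e hXe y.1.1 (by rw [h1]; simp), h5⟩)
            exact iff_of_false n1 n2
      exact hcL.imp_of_mem_imp (fun x y hx hy hxy => hP x hx y hxy)
    intro a b c d hs
    obtain ⟨l, hl, he⟩ := List.sublist_map_iff.1 hs
    match l, he with
    | [a', b', c', d'], he =>
      simp only [List.map_cons, List.map_nil, List.cons.injEq, and_true] at he
      obtain ⟨rfl, rfl, rfl, rfl⟩ := he
      have key := iv_aux (S := fun u => T.Anc w u.1.1) hch hc2 hl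
      constructor
      · rintro ⟨k1, k2, k3, k4⟩
        exact key (by simp [k1, k2]) (by simp [k2, k3]) (by simp [k3, k4])
      · rintro ⟨k1, k2, k3, k4⟩
        exact key (by simp [k1, k2]) (by simp [k2, k3]) (by simp [k3, k4])
    | [], he => simp at he
    | [_], he => simp at he
    | [_, _], he => simp at he
    | [_, _, _], he => simp at he
    | _ :: _ :: _ :: _ :: _ :: _, he => simp at he
  have hKe : ∀ e, ∃ x y, K x y ∧ M.ends e = s(x.1, y.1) := by
    intro e
    obtain ⟨p, hp⟩ := emb.exists_occ e
    exact h.hK e p.1 (Finset.mem_univ _) ((CWalk.cnt_pos _ _).2 ⟨p.2, hp⟩)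
  have hcov : ∀ v, v ≠ T.r → ∃ p ∈ L.map Prod.fst, p.1 = v := by
    intro v hv
    obtain ⟨x, y, h1, h2⟩ := hKe (te v)
    rw [hT v hv] at h2
    have h3 := geo.kin x y h1
    rcases Sym2.eq_iff.1 h2 with ⟨h5, h6⟩ | ⟨h5, h6⟩
    · exact ⟨x, h3.1, h5.symm⟩
    · exact ⟨y, h3.2, h5.symm⟩
  obtain ⟨n, A, col, h1, h2, h3, h4⟩ := partB T (fun p : V × ℕ => p.1) K (max (2 * g) 3) (le_max_right _ _) geo.ks
    (L.map Prod.fst) geo.nd (by simpa using geo.len) geo.nc Z (Or.inl rfl) hcl hcnt hiv hcov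
  refine ⟨n, A, col, T.dep, h1, h2, h3, ?_⟩
  intro u v huv
  refine ⟨⟨hdep u v huv, hdep v u huv.symm⟩, ?_⟩
  obtain ⟨_, e, he⟩ := huv
  obtain ⟨x, y, k1, k2⟩ := hKe e
  have k3 := geo.kin x y k1
  have k4 := h4 x k3.1 y k3.2 k1
  rw [he] at k2
  rcases Sym2.eq_iff.1 k2 with ⟨h5, h6⟩ | ⟨h5, h6⟩
  · rw [h5, h6]; exact k4
  · rw [h5, h6]
    exact k4.imp Eq.symm h1.symm

end Main


/-- For every integer `g ≥ 0`, every graph with Euler genus `g` is contained in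
`H ⊠ P ⊠ K_{max{2g,3}}` for some planar graph `H` with treewidth at most 3 and for
some path `P`. -/
theorem genus_product_structure_planar {V : Type} (g : ℕ) (G : SimpleGraph V)
    (hG : HasEulerGenusLE G g) :
    ∃ (W : Type) (H : SimpleGraph W) (n : ℕ),
      IsPlanar H ∧ TreewidthLE H 3 ∧
      G.IsContainedIn
        ((H.strongProd (SimpleGraph.pathGraph n)).strongProd
          (SimpleGraph.completeGraph (Fin (max (2 * g) 3)))) := by
  classical
  obtain ⟨V', E', F', hV, hE, hF, M, emb, hg, φ, hφ⟩ := hG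
  rcases isEmpty_or_nonempty E' with hE0 | hE0
  · have hno : ∀ u v, ¬ M.simple.Adj u v := by
      rintro u v ⟨_, e, _⟩
      exact hE0.elim e
    have hsub : ∀ u v : V', u = v := by
      intro u v
      obtain ⟨w⟩ := emb.conn.preconnected u v
      cases w with
      | nil => rfl
      | cons h _ => exact absurd h (hno _ _)
    obtain ⟨A, hA⟩ := HS.base
    refine ⟨Fin 1, ⊥, 1, hA.planar ⊥ (fun i j h => absurd h (by simp)),
      hA.treewidth one_pos ⊥ (fun i j h => absurd h (by simp)),
      ⟨⟨fun _ => ((0, 0), ⟨0, by omega⟩), ?_⟩, ?_⟩⟩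
    · intro a b hab
      exact absurd (φ.map_adj hab) (hno _ _)
    · intro a b _
      exact hφ (hsub _ _)
  · obtain ⟨n, A, col, dep, hA, hcol, hcnt, hadj⟩ := exists_col M emb hE0 g hg
    have hn : 0 < n := by
      obtain ⟨v⟩ := emb.conn.nonempty
      exact lt_of_le_of_lt (Nat.zero_le _) (hcol v)
    let H : SimpleGraph (Fin n) :=
      { Adj := fun i j => i ≠ j ∧ A i j
        symm := ⟨fun i j h => ⟨h.1.symm, hA.symm h.2⟩⟩
        loopless := ⟨fun i h => h.1 rfl⟩ }
    obtain ⟨D, hD⟩ : ∃ D, ∀ v, dep v < D := by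
      obtain ⟨B, hB⟩ := (Set.finite_range dep).bddAbove
      exact ⟨B + 1, fun v => Nat.lt_succ_of_le (hB ⟨v, rfl⟩)⟩
    obtain ⟨idx, hidx⟩ := idx_exists (fun v => (col v, dep v)) (max (2 * g) 3) (by
      rintro ⟨c, d⟩
      simpa using hcnt c d)
    have hinj : ∀ a b : V, (((⟨col (φ a), hcol _⟩ : Fin n), (⟨dep (φ a), hD _⟩ : Fin D)), idx (φ a)) =
        (((⟨col (φ b), hcol _⟩ : Fin n), (⟨dep (φ b), hD _⟩ : Fin D)), idx (φ b)) → a = b := by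
      intro a b h
      simp only [Prod.mk.injEq, Fin.mk.injEq] at h
      exact hφ (hidx _ _ (Prod.ext h.1.1 h.1.2) h.2)
    refine ⟨Fin n, H, D, hA.planar H (fun i j h => h.2), hA.treewidth hn H (fun i j h => h.2),
      ⟨⟨fun v => (((⟨col (φ v), hcol _⟩ : Fin n), (⟨dep (φ v), hD _⟩ : Fin D)), idx (φ v)), ?_⟩,
        fun a b h => hinj a b h⟩⟩
    intro a b hab
    obtain ⟨⟨h1, h2⟩, h3⟩ := hadj _ _ (φ.map_adj hab)
    refine ⟨fun h => hab.ne (hinj a b h), ?_, ?_⟩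
    · by_cases hc : col (φ a) = col (φ b)
      · by_cases hd : dep (φ a) = dep (φ b)
        · left
          simp [hc, hd]
        · right
          refine ⟨fun h => hd ?_, Or.inl (by simp [hc]), Or.inr ?_⟩
          · simp only [Prod.mk.injEq, Fin.mk.injEq] at h
            exact h.2
          · rw [SimpleGraph.pathGraph_adj]
            simp only
            omega
      · right
        refine ⟨fun h => hc ?_, Or.inr ⟨fun h => hc ?_, h3.resolve_left hc⟩, ?_⟩
        · simp only [Prod.mk.injEq, Fin.mk.injEq] at h
          exact h.1
        · simpa using h
        · by_cases hd : dep (φ a) = dep (φ b)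
          · left
            simp [hd]
          · right
            rw [SimpleGraph.pathGraph_adj]
            simp only
            omega
    · by_cases hi : idx (φ a) = idx (φ b)
      · exact Or.inl hi
      · exact Or.inr hi
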